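/- arXiv:1703.07891 — 8 statements merged into one kernel-verified Lean document; each statement's English description precedes it below -/
import Mathlib

section
/- If a Boolean function f : (Fin n → Bool) → Bool is computed by a deterministic k-OBDD of width w with order π, then N^π(f) ≤ w^((k−1)·w + 1). -/
/-- The bit read at step `t` by an OBDD with variable order `π` on input `x`:
at step `t` the variable `x (π (t mod n))` is read. -/
def readBit {n : ℕ} (π : Equiv.Perm (Fin n)) (x : Fin n → Bool) (t : ℕ) : Bool :=
  if h : 0 < n then x (π ⟨t % n, Nat.mod_lt t h⟩) else false

/-- The state of a deterministic (k-)OBDD of width `w` with order `π`, start state `s`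
and transition functions `δ` after `t` steps on input `x`. -/
def detState {n w : ℕ} (π : Equiv.Perm (Fin n)) (s : Fin w)
    (δ : ℕ → Fin w → Bool → Fin w) (x : Fin n → Bool) : ℕ → Fin w
  | 0 => s
  | t + 1 => δ t (detState π s δ x t) (readBit π x t)

/-- `N^{π,u}(f)`: the number of distinct subfunctions of `f` obtained by fixing the
variables `x_{π 0}, …, x_{π (u-1)}` to constants. -/
noncomputable def subfunCount (n : ℕ) (f : (Fin n → Bool) → Bool) (π : Equiv.Perm (Fin n)) (u : ℕ) : ℕ :=
  Set.ncard { g : (Fin n → Bool) → Bool |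
    ∃ ρ : Fin n → Bool,
      g = fun y => f (fun i => if ((π.symm i : Fin n) : ℕ) < u then ρ i else y i) }

/-- The state reached from `q` at time `t` after `m` more steps on input `x`. -/
def runFrom {n w : ℕ} (π : Equiv.Perm (Fin n))
    (δ : ℕ → Fin w → Bool → Fin w) (x : Fin n → Bool) (q : Fin w) (t : ℕ) : ℕ → Fin w
  | 0 => q
  | m + 1 => δ (t + m) (runFrom π δ x q t m) (readBit π x (t + m))

theorem detState_add {n w : ℕ} (π : Equiv.Perm (Fin n)) (s : Fin w)
    (δ : ℕ → Fin w → Bool → Fin w) (x : Fin n → Bool) (t m : ℕ) :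
    detState π s δ x (t + m) = runFrom π δ x (detState π s δ x t) t m := by
  induction m with
  | zero => rfl
  | succ m ih =>
    rw [← Nat.add_assoc]
    simp only [detState, runFrom, ih]

theorem runFrom_congr {n w : ℕ} (π : Equiv.Perm (Fin n))
    (δ : ℕ → Fin w → Bool → Fin w) (x x' : Fin n → Bool) (q : Fin w) (t m : ℕ)
    (h : ∀ i < m, readBit π x (t + i) = readBit π x' (t + i)) :
    runFrom π δ x q t m = runFrom π δ x' q t m := by
  induction m with
  | zero => rfl
  | succ m ih =>
    simp only [runFrom]
    rw [ih (fun i hi => h i (by omega)), h m (by omega)]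

/-- Combination of `ρ` on the first `u` variables and `y` on the others. -/
def mixIn {n : ℕ} (π : Equiv.Perm (Fin n)) (u : ℕ) (ρ y : Fin n → Bool) : Fin n → Bool :=
  fun i => if ((π.symm i : Fin n) : ℕ) < u then ρ i else y i

theorem readBit_mixIn {n : ℕ} (π : Equiv.Perm (Fin n)) (u : ℕ) (ρ y : Fin n → Bool) (t : ℕ) :
    readBit π (mixIn π u ρ y) t = if t % n < u then readBit π ρ t else readBit π y t := by
  unfold readBit mixIn
  by_cases h : 0 < n <;> simp [h]

theorem runFrom_mixIn_fst {n w : ℕ} (π : Equiv.Perm (Fin n)) (δ : ℕ → Fin w → Bool → Fin w)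
    (u : ℕ) (hu : u < n) (ρ y : Fin n → Bool) (q : Fin w) (j : ℕ) :
    runFrom π δ (mixIn π u ρ y) q (j * n) u = runFrom π δ ρ q (j * n) u := by
  apply runFrom_congr
  intro i hi
  have h1 : (j * n + i) % n = i := by
    rw [Nat.mul_add_mod', Nat.mod_eq_of_lt (by omega)]
  rw [readBit_mixIn, h1, if_pos hi]

theorem runFrom_mixIn_snd {n w : ℕ} (π : Equiv.Perm (Fin n)) (δ : ℕ → Fin w → Bool → Fin w)
    (u : ℕ) (hu : u < n) (ρ y : Fin n → Bool) (q : Fin w) (j : ℕ) :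
    runFrom π δ (mixIn π u ρ y) q (j * n + u) (n - u) =
      runFrom π δ y q (j * n + u) (n - u) := by
  apply runFrom_congr
  intro i hi
  have h1 : (j * n + u + i) % n = u + i := by
    rw [Nat.add_assoc, Nat.mul_add_mod', Nat.mod_eq_of_lt (by omega)]
  rw [readBit_mixIn, h1, if_neg (by omega)]

/-- If `f` is computed by a deterministic `k`-OBDD of width `w` with order `π`,
then `N^π(f) ≤ w^((k-1)·w + 1)`, i.e. the bound holds for every cut `1 ≤ u < n`. -/
theorem det_kOBDD_subfunction_bound {n k w : ℕ} (f : (Fin n → Bool) → Bool)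
    (π : Equiv.Perm (Fin n)) (s : Fin w) (δ : ℕ → Fin w → Bool → Fin w)
    (A : Finset (Fin w))
    (hcomp : ∀ x : Fin n → Bool, detState π s δ x (k * n) ∈ A ↔ f x = true) :
    ∀ u : ℕ, 1 ≤ u → u < n → subfunCount n f π u ≤ w ^ ((k - 1) * w + 1) := by
  intro u _ hun
  let G : (Fin n → Bool) → ((Fin n → Bool) → Bool) := fun ρ y => f (mixIn π u ρ y)
  let sig : (Fin n → Bool) → Fin w × (Fin (k - 1) → Fin w → Fin w) := fun ρ =>
    (runFrom π δ ρ s (0 * n) u, fun j q => runFrom π δ ρ q ((j.1 + 1) * n) u)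
  have hfac : Function.FactorsThrough G sig := by
    intro ρ ρ' hs
    have hs1 : runFrom π δ ρ s (0 * n) u = runFrom π δ ρ' s (0 * n) u := congrArg Prod.fst hs
    have hs2 : ∀ (j : Fin (k - 1)) (q : Fin w), runFrom π δ ρ q ((j.1 + 1) * n) u =
        runFrom π δ ρ' q ((j.1 + 1) * n) u := fun j q =>
      congrFun (congrFun (congrArg Prod.snd hs) j) q
    funext y
    have key : ∀ j ≤ k, detState π s δ (mixIn π u ρ y) (j * n) =
        detState π s δ (mixIn π u ρ' y) (j * n) := by
      intro j
      induction j with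
      | zero => intro _; simp [detState]
      | succ j ih =>
        intro hj
        have ih := ih (by omega)
        have e : (j + 1) * n = j * n + u + (n - u) := by
          rw [Nat.succ_mul]; omega
        have mid : detState π s δ (mixIn π u ρ y) (j * n + u) =
            detState π s δ (mixIn π u ρ' y) (j * n + u) := by
          rw [detState_add, detState_add, ih, runFrom_mixIn_fst π δ u hun,
            runFrom_mixIn_fst π δ u hun]
          cases j with
          | zero =>
            have e0 : detState π s δ (mixIn π u ρ' y) (0 * n) = s := by simp [detState]
            rw [e0]; exact hs1
          | succ j => exact hs2 ⟨j, by omega⟩ _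
        rw [e, detState_add π s δ _ (j * n + u), detState_add π s δ (mixIn π u ρ' y) (j * n + u), mid, runFrom_mixIn_snd π δ u hun,
          runFrom_mixIn_snd π δ u hun]
    have h1 := hcomp (mixIn π u ρ y)
    have h2 := hcomp (mixIn π u ρ' y)
    rw [key k le_rfl] at h1
    exact Bool.eq_iff_iff.mpr (h1.symm.trans h2)
  obtain ⟨h, hh⟩ := (Function.factorsThrough_iff _).mp hfac
  have hsub : { g : (Fin n → Bool) → Bool |
    ∃ ρ : Fin n → Bool,
      g = fun y => f (fun i => if ((π.symm i : Fin n) : ℕ) < u then ρ i else y i) } ⊆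
      Set.image h Set.univ := by
    rintro g ⟨ρ, rfl⟩
    exact ⟨sig ρ, trivial, (congrFun hh ρ).symm⟩
  unfold subfunCount
  calc _ ≤ (Set.image h Set.univ).ncard := Set.ncard_le_ncard hsub (Set.toFinite _)
    _ ≤ (Set.univ : Set (Fin w × (Fin (k - 1) → Fin w → Fin w))).ncard :=
      Set.ncard_image_le (Set.toFinite _)
    _ = w ^ ((k - 1) * w + 1) := by
      rw [Set.ncard_univ, Nat.card_eq_fintype_card]
      simp only [Fintype.card_prod, Fintype.card_fun, Fintype.card_fin]
      rw [← pow_mul, pow_succ, Nat.mul_comm w (k - 1), Nat.mul_comm]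
end

section
/- If a Boolean function f : (Fin n → Bool) → Bool is computed by a nondeterministic k-OBDD of width w with order π, then N^π(f) ≤ 2^(w·((k−1)·w + 1)). -/
/-- A nondeterministic `k`-OBDD of width `w` with order `π`, start state `s`,
transition relations `δ` and accepting set `A` accepts input `x` if there is a run
`q 0 = s`, `q (j+1) ∈ δ j (q j) (bit read at step j)` for all `j < k·n`,
ending in an accepting state. -/
def nondetAccepts {n w : ℕ} (k : ℕ) (π : Equiv.Perm (Fin n)) (s : Fin w)
    (δ : ℕ → Fin w → Bool → Set (Fin w)) (A : Set (Fin w)) (x : Fin n → Bool) : Prop :=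
  ∃ q : ℕ → Fin w, q 0 = s ∧
    (∀ j < k * n, q (j + 1) ∈ δ j (q j) (readBit π x j)) ∧ q (k * n) ∈ A

/-- There is a partial run from state `p` at time `a` to state `q` at time `b`. -/
def obddReach {n w : ℕ} (π : Equiv.Perm (Fin n)) (δ : ℕ → Fin w → Bool → Set (Fin w))
    (x : Fin n → Bool) (a b : ℕ) (p q : Fin w) : Prop :=
  ∃ r : ℕ → Fin w, r a = p ∧ r b = q ∧
    ∀ j, a ≤ j → j < b → r (j + 1) ∈ δ j (r j) (readBit π x j)

/-- Fix the first `u` variables to `ρ`. -/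
def obddMix {n : ℕ} (π : Equiv.Perm (Fin n)) (u : ℕ) (ρ y : Fin n → Bool) : Fin n → Bool :=
  fun i => if ((π.symm i : Fin n) : ℕ) < u then ρ i else y i

/-- The behaviour of the program on the first blocks of all passes. -/
def obddSig {n w : ℕ} (k : ℕ) (π : Equiv.Perm (Fin n)) (s : Fin w)
    (δ : ℕ → Fin w → Bool → Set (Fin w)) (u : ℕ) (ρ : Fin n → Bool) :
    Set (Fin w) × (Fin (k - 1) → Set (Fin w × Fin w)) :=
  ({q | obddReach π δ ρ 0 u s q},
   fun i => {p | obddReach π δ ρ ((i + 1) * n) ((i + 1) * n + u) p.1 p.2})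

lemma readBit_mix_lt {n : ℕ} (π : Equiv.Perm (Fin n)) (u : ℕ) (ρ y : Fin n → Bool) (t : ℕ)
    (h : t % n < u) : readBit π (obddMix π u ρ y) t = readBit π ρ t := by
  unfold readBit obddMix
  split_ifs with h0 <;> simp_all

lemma readBit_mix_ge {n : ℕ} (π : Equiv.Perm (Fin n)) (u : ℕ) (ρ y : Fin n → Bool) (t : ℕ)
    (h : u ≤ t % n) : readBit π (obddMix π u ρ y) t = readBit π y t := by
  unfold readBit obddMix
  split_ifs with h0 <;> simp_all
  omega

lemma block_mod {n u i j : ℕ} (hun : u < n) (h1 : i * n ≤ j) (h2 : j < i * n + u) :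
    j % n < u := by
  obtain ⟨m, rfl⟩ := Nat.exists_eq_add_of_le h1
  rw [Nat.mul_add_mod', Nat.mod_eq_of_lt (by omega)]
  omega

lemma accepts_of_sig {n k w : ℕ} (π : Equiv.Perm (Fin n)) (s : Fin w)
    (δ : ℕ → Fin w → Bool → Set (Fin w)) (A : Set (Fin w)) (u : ℕ) (hu : 1 ≤ u) (hun : u < n)
    (ρ ρ' y : Fin n → Bool) (hs : obddSig k π s δ u ρ = obddSig k π s δ u ρ')
    (h : nondetAccepts k π s δ A (obddMix π u ρ y)) :
    nondetAccepts k π s δ A (obddMix π u ρ' y) := by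
  obtain ⟨q, q0, hq, hA⟩ := h
  have key : ∀ i, ∃ r : ℕ → Fin w, r (i * n) = q (i * n) ∧ r (i * n + u) = q (i * n + u) ∧
      (i < k → ∀ j, i * n ≤ j → j < i * n + u → r (j + 1) ∈ δ j (r j) (readBit π ρ' j)) := by
    intro i
    by_cases hi : i < k
    · have hle : i * n + n ≤ k * n := by
        have := Nat.mul_le_mul_right n (Nat.succ_le_of_lt hi)
        rwa [Nat.succ_mul] at this
      have hr : obddReach π δ ρ (i * n) (i * n + u) (q (i * n)) (q (i * n + u)) := by
        refine ⟨q, rfl, rfl, fun j h1 h2 => ?_⟩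
        have := hq j (by omega)
        rwa [readBit_mix_lt π u ρ y j (block_mod hun h1 h2)] at this
      have hr' : obddReach π δ ρ' (i * n) (i * n + u) (q (i * n)) (q (i * n + u)) := by
        cases i with
        | zero =>
          have h1 := Set.ext_iff.1 (congrArg Prod.fst hs) (q u)
          simp only [obddSig, Set.mem_ofPred_eq] at h1
          simp only [Nat.zero_mul, Nat.zero_add, q0] at hr ⊢
          exact h1.1 hr
        | succ i =>
          have h1 := Set.ext_iff.1 (congrFun (congrArg Prod.snd hs) ⟨i, by omega⟩)
            (q ((i + 1) * n), q ((i + 1) * n + u))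
          simp only [obddSig, Set.mem_ofPred_eq] at h1
          exact h1.1 hr
      obtain ⟨r, h1, h2, h3⟩ := hr'
      exact ⟨r, h1, h2, fun _ => h3⟩
    · exact ⟨q, rfl, rfl, fun h => absurd h hi⟩
  choose r ha hb hc using key
  have hn : 0 < n := by omega
  have hd : ∀ i m, m < n → (i * n + m) / n = i ∧ (i * n + m) % n = m := by
    intro i m hm
    constructor
    · rw [Nat.add_comm, Nat.add_mul_div_right _ _ hn, Nat.div_eq_of_lt hm, Nat.zero_add]
    · rw [Nat.mul_add_mod', Nat.mod_eq_of_lt hm]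
  obtain ⟨q', hq'⟩ : ∃ q' : ℕ → Fin w,
      q' = fun t => if t % n < u then r (t / n) t else q t := ⟨_, rfl⟩
  have e1 : ∀ i m, m ≤ u → q' (i * n + m) = r i (i * n + m) := by
    intro i m hm
    obtain ⟨h1, h2⟩ := hd i m (by omega)
    simp only [hq', h1, h2]
    split_ifs with h
    · rfl
    · have : m = u := by omega
      subst this
      exact (hb i).symm
  have e2 : ∀ i m, u ≤ m → m ≤ n → q' (i * n + m) = q (i * n + m) := by
    intro i m hm hmn
    rcases Nat.lt_or_ge m n with h | h
    · obtain ⟨h1, h2⟩ := hd i m h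
      simp only [hq', h1, h2]
      rw [if_neg (by omega)]
    · have : m = n := by omega
      subst this
      have h3 := e1 (i + 1) 0 (by omega)
      have h4 := ha (i + 1)
      rw [Nat.add_zero] at h3
      rw [Nat.succ_mul] at h3 h4
      rw [h3, h4]
  have e0 : ∀ i, q' (i * n) = q (i * n) := by
    intro i
    have h3 := e1 i 0 (by omega)
    rw [Nat.add_zero] at h3
    rw [h3, ha]
  refine ⟨q', ?_, ?_, ?_⟩
  · have := e0 0
    rw [Nat.zero_mul] at this
    rw [this, q0]
  · intro j hj
    have hm : j % n < n := Nat.mod_lt j hn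
    have hi : j / n < k := Nat.div_lt_of_lt_mul (by rwa [Nat.mul_comm])
    have hjj : j / n * n + j % n = j := Nat.div_add_mod' j n
    rcases Nat.lt_or_ge (j % n) u with h | h
    · have f1 := e1 (j / n) (j % n) (by omega)
      have f2 := e1 (j / n) (j % n + 1) (by omega)
      rw [← Nat.add_assoc] at f2
      rw [hjj] at f1 f2
      rw [f1, f2, readBit_mix_lt π u ρ' y j h]
      exact hc _ hi j (by omega) (by omega)
    · have f1 := e2 (j / n) (j % n) (by omega) (by omega)
      have f2 := e2 (j / n) (j % n + 1) (by omega) (by omega)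
      rw [← Nat.add_assoc] at f2
      rw [hjj] at f1 f2
      have := hq j hj
      rw [readBit_mix_ge π u _ y j h] at this
      rw [f1, f2, readBit_mix_ge π u _ y j h]
      exact this
  · rw [e0]
    exact hA

/-- If `f` is computed by a nondeterministic `k`-OBDD of width `w` with order `π`,
then `N^π(f) ≤ 2^(w·((k-1)·w + 1))`, i.e. the bound holds for every cut `1 ≤ u < n`. -/
theorem nondet_kOBDD_subfunction_bound {n k w : ℕ} (f : (Fin n → Bool) → Bool)
    (π : Equiv.Perm (Fin n)) (s : Fin w) (δ : ℕ → Fin w → Bool → Set (Fin w))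
    (A : Set (Fin w))
    (hcomp : ∀ x : Fin n → Bool, nondetAccepts k π s δ A x ↔ f x = true) :
    ∀ u : ℕ, 1 ≤ u → u < n → subfunCount n f π u ≤ 2 ^ (w * ((k - 1) * w + 1)) := by
  intro u hu hun
  have hfac : Function.FactorsThrough (fun ρ => fun y => f (obddMix π u ρ y))
      (obddSig k π s δ u) := by
    intro ρ ρ' h
    funext y
    rw [Bool.eq_iff_iff, ← hcomp, ← hcomp]
    exact ⟨accepts_of_sig π s δ A u hu hun ρ ρ' y h,
      accepts_of_sig π s δ A u hu hun ρ' ρ y h.symm⟩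
  obtain ⟨g, hg⟩ := (Function.factorsThrough_iff _).1 hfac
  have hset : { g : (Fin n → Bool) → Bool |
      ∃ ρ : Fin n → Bool,
        g = fun y => f (fun i => if ((π.symm i : Fin n) : ℕ) < u then ρ i else y i) } ⊆
      g '' Set.univ := by
    rintro _ ⟨ρ, rfl⟩
    exact ⟨obddSig k π s δ u ρ, trivial, (congrFun hg ρ).symm⟩
  unfold subfunCount
  refine (Set.ncard_le_ncard hset (Set.toFinite _)).trans
    ((Set.ncard_image_le (Set.toFinite _)).trans ?_)
  rw [Set.ncard_univ, Nat.card_prod, Nat.card_pi]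
  simp only [Nat.card_eq_fintype_card, Fintype.card_set, Fintype.card_prod, Fintype.card_fin,
    Finset.prod_const, Finset.card_univ]
  rw [← pow_mul, ← pow_add]
  apply le_of_eq
  congr 1
  ring
end

section
/- For every ε with 0 < ε ≤ 1/2 there exist constants C₁ > 0 and C₂ > 0 such that: if a Boolean function f : (Fin n → Bool) → Bool is computed with error at most 1/2 − ε by a probabilistic k-OBDD of width w ≥ 2 with order π, where k ≥ 2, then N^π(f) ≤ (C₁·k·(C₂ + log₂ w + log₂ k))^((k+1)·w²). -/
/-- The probability distribution (row vector) over the states of a probabilistic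
(k-)OBDD with order `π`, initial distribution `v0` and stochastic transition matrices `M`
after `t` steps on input `x`. -/
noncomputable def probDist {n w : ℕ} (π : Equiv.Perm (Fin n)) (v0 : Fin w → ℝ)
    (M : ℕ → Bool → Matrix (Fin w) (Fin w) ℝ) (x : Fin n → Bool) : ℕ → Fin w → ℝ
  | 0 => v0
  | t + 1 => Matrix.vecMul (probDist π v0 M x t) (M t (readBit π x t))

/-- Product of the transition matrices of the `l` steps starting at step `s`. -/
noncomputable def segProd {n w : ℕ} (π : Equiv.Perm (Fin n))
    (M : ℕ → Bool → Matrix (Fin w) (Fin w) ℝ) (x : Fin n → Bool) (s : ℕ) :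
    ℕ → Matrix (Fin w) (Fin w) ℝ
  | 0 => 1
  | l + 1 => segProd π M x s l * M (s + l) (readBit π x (s + l))

theorem probDist_add {n w : ℕ} (π : Equiv.Perm (Fin n)) (v0 : Fin w → ℝ)
    (M : ℕ → Bool → Matrix (Fin w) (Fin w) ℝ) (x : Fin n → Bool) (s l : ℕ) :
    probDist π v0 M x (s + l) = Matrix.vecMul (probDist π v0 M x s) (segProd π M x s l) := by
  induction l with
  | zero => simp [segProd]
  | succ l ih =>
    rw [← Nat.add_assoc]
    simp only [probDist, segProd]
    rw [ih, Matrix.vecMul_vecMul]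

theorem segProd_congr {n w : ℕ} (π : Equiv.Perm (Fin n))
    (M : ℕ → Bool → Matrix (Fin w) (Fin w) ℝ) (x y : Fin n → Bool) (s l : ℕ)
    (h : ∀ j < l, readBit π x (s + j) = readBit π y (s + j)) :
    segProd π M x s l = segProd π M y s l := by
  induction l with
  | zero => rfl
  | succ l ih =>
    simp only [segProd]
    rw [ih (fun j hj => h j (by omega)), h l (by omega)]

theorem segProd_stoch {n w : ℕ} (π : Equiv.Perm (Fin n))
    (M : ℕ → Bool → Matrix (Fin w) (Fin w) ℝ)
    (h0 : ∀ j b i i', 0 ≤ M j b i i') (h1 : ∀ j b i, ∑ i', M j b i i' = 1)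
    (x : Fin n → Bool) (s l : ℕ) :
    (∀ i i', 0 ≤ segProd π M x s l i i') ∧ (∀ i, ∑ i', segProd π M x s l i i' = 1) := by
  induction l with
  | zero =>
    constructor
    · intro i i'
      simp only [segProd, Matrix.one_apply]
      split_ifs <;> norm_num
    · intro i
      simp [segProd, Matrix.one_apply]
  | succ l ih =>
    constructor
    · intro i i'
      simp only [segProd, Matrix.mul_apply]
      exact Finset.sum_nonneg fun j _ => mul_nonneg (ih.1 _ _) (h0 _ _ _ _)
    · intro i
      simp only [segProd, Matrix.mul_apply]
      rw [Finset.sum_comm]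
      simp_rw [← Finset.mul_sum, h1, mul_one]
      exact ih.2 i

theorem vecMul_stoch {w : ℕ} (v : Fin w → ℝ) (Q : Matrix (Fin w) (Fin w) ℝ)
    (hv0 : ∀ i, 0 ≤ v i) (hv1 : ∑ i, v i = 1)
    (hQ0 : ∀ i i', 0 ≤ Q i i') (hQ1 : ∀ i, ∑ i', Q i i' = 1) :
    (∀ i, 0 ≤ Matrix.vecMul v Q i) ∧ ∑ i, Matrix.vecMul v Q i = 1 := by
  simp only [Matrix.vecMul, dotProduct]
  constructor
  · intro i
    exact Finset.sum_nonneg fun j _ => mul_nonneg (hv0 _) (hQ0 _ _)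
  · rw [Finset.sum_comm]
    simp_rw [← Finset.mul_sum, hQ1, mul_one]
    exact hv1

theorem probDist_stoch {n w : ℕ} (π : Equiv.Perm (Fin n)) (v0 : Fin w → ℝ)
    (M : ℕ → Bool → Matrix (Fin w) (Fin w) ℝ)
    (hv0 : ∀ i, 0 ≤ v0 i) (hv1 : ∑ i, v0 i = 1)
    (h0 : ∀ j b i i', 0 ≤ M j b i i') (h1 : ∀ j b i, ∑ i', M j b i i' = 1)
    (x : Fin n → Bool) (t : ℕ) :
    (∀ i, 0 ≤ probDist π v0 M x t i) ∧ ∑ i, probDist π v0 M x t i = 1 := by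
  induction t with
  | zero => exact ⟨hv0, hv1⟩
  | succ t ih => exact vecMul_stoch _ _ ih.1 ih.2 (h0 _ _) (h1 _ _)

theorem hybrid_step {w : ℕ} (v v' : Fin w → ℝ) (Q Q' : Matrix (Fin w) (Fin w) ℝ) (η : ℝ)
    (hv0 : ∀ i, 0 ≤ v i) (hv1 : ∑ i, v i = 1)
    (hQ0 : ∀ i i', 0 ≤ Q' i i') (hQ1 : ∀ i, ∑ i', Q' i i' = 1)
    (hd : ∀ i, ∑ i', |Q i i' - Q' i i'| ≤ η) :
    ∑ i, |Matrix.vecMul v Q i - Matrix.vecMul v' Q' i| ≤ ∑ i, |v i - v' i| + η := by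
  have key : ∀ i, |Matrix.vecMul v Q i - Matrix.vecMul v' Q' i| ≤
      ∑ j, (|v j - v' j| * Q' j i + v j * |Q j i - Q' j i|) := by
    intro i
    simp only [Matrix.vecMul, dotProduct]
    rw [← Finset.sum_sub_distrib]
    refine (Finset.abs_sum_le_sum_abs _ _).trans (Finset.sum_le_sum fun j _ => ?_)
    have : v j * Q j i - v' j * Q' j i = (v j - v' j) * Q' j i + v j * (Q j i - Q' j i) := by ring
    rw [this]
    refine (abs_add_le _ _).trans ?_
    rw [abs_mul, abs_mul, abs_of_nonneg (hQ0 j i), abs_of_nonneg (hv0 j)]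
  refine (Finset.sum_le_sum fun i _ => key i).trans ?_
  rw [Finset.sum_comm]
  simp_rw [Finset.sum_add_distrib, ← Finset.mul_sum, hQ1, mul_one]
  have : ∑ j, v j * ∑ i, |Q j i - Q' j i| ≤ ∑ j, v j * η :=
    Finset.sum_le_sum fun j _ => mul_le_mul_of_nonneg_left (hd j) (hv0 j)
  rw [← Finset.sum_mul, hv1, one_mul] at this
  linarith

/-- Index of the cell of the logarithmic grid in which `a` lies. -/
noncomputable def cell (α δ a : ℝ) : ℕ :=
  if a < α then 0 else 1 + ⌊Real.log (a / α) / δ⌋₊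

theorem cell_close_aux (α δ a b : ℝ) (hα : 0 < α) (hδ : 0 < δ) (hb : 0 ≤ b) (hba : b ≤ a)
    (h : cell α δ a = cell α δ b) : |a - b| ≤ δ * (a + b) + α := by
  have ha : 0 ≤ a := hb.trans hba
  rw [abs_of_nonneg (by linarith)]
  unfold cell at h
  have hp : 0 ≤ δ * (a + b) := by positivity
  split_ifs at h with h1 h2 h2
  · linarith
  · omega
  · omega
  · push Not at h1 h2
    have hb' : 0 < b := lt_of_lt_of_le hα h2
    have ha' : 0 < a := lt_of_lt_of_le hα h1
    have hf : ⌊Real.log (a / α) / δ⌋₊ = ⌊Real.log (b / α) / δ⌋₊ := by omega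
    have hlb : 0 ≤ Real.log (b / α) / δ := by
      apply div_nonneg _ hδ.le
      apply Real.log_nonneg
      rw [le_div_iff₀ hα]; linarith
    have e1 := Nat.lt_floor_add_one (Real.log (a / α) / δ)
    have e2 := Nat.floor_le hlb
    rw [hf] at e1
    have e3 : Real.log (a / α) / δ - Real.log (b / α) / δ < 1 := by linarith
    rw [← sub_div, div_lt_one hδ, Real.log_div ha'.ne' hα.ne', Real.log_div hb'.ne' hα.ne'] at e3
    have e4 := Real.one_sub_inv_le_log_of_pos (div_pos ha' hb')
    rw [Real.log_div ha'.ne' hb'.ne', inv_div] at e4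
    have e5 : 1 - b / a ≤ δ := by linarith
    have e6 : a - b ≤ δ * a := by
      have := mul_le_mul_of_nonneg_right e5 ha
      rwa [sub_mul, one_mul, div_mul_cancel₀ _ ha'.ne'] at this
    nlinarith [mul_pos hδ hb']

theorem cell_close (α δ a b : ℝ) (hα : 0 < α) (hδ : 0 < δ) (ha : 0 ≤ a) (hb : 0 ≤ b)
    (h : cell α δ a = cell α δ b) : |a - b| ≤ δ * (a + b) + α := by
  rcases le_total b a with hba | hab
  · exact cell_close_aux α δ a b hα hδ hb hba h
  · rw [abs_sub_comm, add_comm a b]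
    exact cell_close_aux α δ b a hα hδ ha hab h.symm

theorem cell_lt (α δ a : ℝ) (hα : 0 < α) (hδ : 0 < δ) (ha : a ≤ 1) :
    cell α δ a < ⌊Real.log (1 / α) / δ⌋₊ + 2 := by
  unfold cell
  split_ifs with h
  · omega
  · push Not at h
    have ha' : 0 < a := lt_of_lt_of_le hα h
    have : ⌊Real.log (a / α) / δ⌋₊ ≤ ⌊Real.log (1 / α) / δ⌋₊ := by
      apply Nat.floor_le_floor
      gcongr
    omega

theorem row_close {w : ℕ} (α δ : ℝ) (hα : 0 < α) (hδ : 0 < δ) (p q : Fin w → ℝ)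
    (hp : ∀ i, 0 ≤ p i) (hq : ∀ i, 0 ≤ q i) (hp1 : ∑ i, p i = 1) (hq1 : ∑ i, q i = 1)
    (h : ∀ i, cell α δ (p i) = cell α δ (q i)) :
    ∑ i, |p i - q i| ≤ 2 * δ + w * α := by
  refine (Finset.sum_le_sum fun i _ => cell_close α δ _ _ hα hδ (hp i) (hq i) (h i)).trans ?_
  rw [Finset.sum_add_distrib, ← Finset.mul_sum, Finset.sum_add_distrib, hp1, hq1]
  simp
  linarith

/-- The input which agrees with `ρ` on the first `u` variables and with `y` on the others. -/
def mix {n : ℕ} (π : Equiv.Perm (Fin n)) (u : ℕ) (ρ y : Fin n → Bool) : Fin n → Bool :=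
  fun i => if ((π.symm i : Fin n) : ℕ) < u then ρ i else y i

theorem readBit_mix {n : ℕ} (π : Equiv.Perm (Fin n)) (u : ℕ) (ρ y : Fin n → Bool) (p r : ℕ)
    (hr : r < n) : readBit π (mix π u ρ y) (p * n + r) =
      if r < u then readBit π ρ (p * n + r) else readBit π y (p * n + r) := by
  have hn : 0 < n := by omega
  have hm : (p * n + r) % n = r := by
    rw [Nat.add_comm, Nat.add_mul_mod_self_right, Nat.mod_eq_of_lt hr]
  simp [readBit, mix, hn, hm]

theorem hybrid_main {n w k : ℕ} (π : Equiv.Perm (Fin n)) (v0 : Fin w → ℝ)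
    (M : ℕ → Bool → Matrix (Fin w) (Fin w) ℝ)
    (hv0 : ∀ i, 0 ≤ v0 i) (hv1 : ∑ i, v0 i = 1)
    (h0 : ∀ j b i i', 0 ≤ M j b i i') (h1 : ∀ j b i, ∑ i', M j b i i' = 1)
    (u : ℕ) (hu : u < n) (ρ ρ' y : Fin n → Bool) (η : ℝ)
    (hd : ∀ p < k, ∀ i,
      ∑ i', |segProd π M ρ (p * n) u i i' - segProd π M ρ' (p * n) u i i'| ≤ η)
    (p : ℕ) (hp : p ≤ k) :
    ∑ i, |probDist π v0 M (mix π u ρ y) (p * n) i - probDist π v0 M (mix π u ρ' y) (p * n) i|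
      ≤ p * η := by
  induction p with
  | zero => simp [probDist]
  | succ p ih =>
    have ih' := ih (by omega)
    have hs : (p + 1) * n = (p * n + u) + (n - u) := by
      rw [add_mul]; omega
    have g : ∀ σ : Fin n → Bool,
        segProd π M (mix π u σ y) (p * n) u = segProd π M σ (p * n) u := by
      intro σ
      apply segProd_congr
      intro j hj
      rw [readBit_mix _ _ _ _ _ _ (by omega), if_pos hj]
    have g2 : segProd π M (mix π u ρ y) (p * n + u) (n - u) =
        segProd π M (mix π u ρ' y) (p * n + u) (n - u) := by
      apply segProd_congr
      intro j hj
      rw [Nat.add_assoc, readBit_mix _ _ _ _ _ _ (by omega), readBit_mix _ _ _ _ _ _ (by omega),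
        if_neg (by omega), if_neg (by omega)]
    have st := fun x t => probDist_stoch π v0 M hv0 hv1 h0 h1 x t
    have sg := fun x s l => segProd_stoch π M h0 h1 x s l
    have a1 := hybrid_step (probDist π v0 M (mix π u ρ y) (p * n))
      (probDist π v0 M (mix π u ρ' y) (p * n)) (segProd π M (mix π u ρ y) (p * n) u)
      (segProd π M (mix π u ρ' y) (p * n) u) η (st _ _).1 (st _ _).2 (sg _ _ _).1 (sg _ _ _).2
      (by rw [g, g]; exact hd p (by omega))
    have a2 := hybrid_step (probDist π v0 M (mix π u ρ y) (p * n + u))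
      (probDist π v0 M (mix π u ρ' y) (p * n + u))
      (segProd π M (mix π u ρ y) (p * n + u) (n - u))
      (segProd π M (mix π u ρ' y) (p * n + u) (n - u)) 0
      (st _ _).1 (st _ _).2 (sg _ _ _).1 (sg _ _ _).2
      (by rw [g2]; simp)
    rw [← probDist_add, ← probDist_add] at a1 a2
    rw [hs]
    push_cast
    linarith

theorem ncard_range_le_of_code {X Y Z : Type*} [Fintype Z] [Nonempty Y] (G : X → Y) (c : X → Z)
    (h : ∀ a b, c a = c b → G a = G b) : (Set.range G).ncard ≤ Fintype.card Z := by
  classical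
  obtain ⟨y0⟩ := ‹Nonempty Y›
  have hsub : Set.range G ⊆ (Function.extend c G fun _ => y0) '' Set.univ := by
    rintro _ ⟨a, rfl⟩
    refine ⟨c a, trivial, ?_⟩
    exact Function.FactorsThrough.extend_apply (fun a b hab => h a b hab) _ a
  refine (Set.ncard_le_ncard hsub (Set.toFinite _)).trans ?_
  refine (Set.ncard_image_le (Set.toFinite _)).trans ?_
  rw [Set.ncard_univ, Nat.card_eq_fintype_card]

/-- For every `ε ∈ (0, 1/2]` there are constants `C₁, C₂ > 0` such that: if `f` is
computed with error at most `1/2 - ε` by a probabilistic `k`-OBDD of width `w ≥ 2`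
with order `π`, where `k ≥ 2`, then `N^π(f) ≤ (C₁·k·(C₂ + log₂ w + log₂ k))^((k+1)·w²)`. -/
theorem prob_kOBDD_subfunction_bound :
    ∀ ε : ℝ, 0 < ε → ε ≤ 1 / 2 →
    ∃ C₁ C₂ : ℝ, 0 < C₁ ∧ 0 < C₂ ∧
      ∀ (n k w : ℕ) (f : (Fin n → Bool) → Bool) (π : Equiv.Perm (Fin n))
        (v0 : Fin w → ℝ) (M : ℕ → Bool → Matrix (Fin w) (Fin w) ℝ) (A : Finset (Fin w)),
        2 ≤ k → 2 ≤ w →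
        (∀ i, 0 ≤ v0 i) → (∑ i, v0 i) = 1 →
        (∀ j b i i', 0 ≤ M j b i i') → (∀ j b i, ∑ i', M j b i i' = 1) →
        (∀ x, f x = true → 1 / 2 + ε ≤ ∑ i ∈ A, probDist π v0 M x (k * n) i) →
        (∀ x, f x = false → ∑ i ∈ A, probDist π v0 M x (k * n) i ≤ 1 / 2 - ε) →
        ∀ u : ℕ, 1 ≤ u → u < n →
          (subfunCount n f π u : ℝ) ≤
            (C₁ * k * (C₂ + Real.logb 2 w + Real.logb 2 k)) ^ ((k + 1) * w ^ 2) := by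
  intro ε hε hε2
  have hL : 0 < Real.log (2 / ε) := by
    apply Real.log_pos
    rw [lt_div_iff₀ hε]; linarith
  refine ⟨4 / ε, 1 + Real.log (2 / ε), by positivity, by positivity, ?_⟩
  intro n k w f π v0 M A hk hw hv0 hv1 h0 h1 hacc hrej u hu1 hun
  have hkR : (2 : ℝ) ≤ k := by exact_mod_cast hk
  have hwR : (2 : ℝ) ≤ w := by exact_mod_cast hw
  have hk0 : (0 : ℝ) < k := by linarith
  have hw0 : (0 : ℝ) < w := by linarith
  obtain ⟨δ, hδ⟩ : ∃ δ : ℝ, δ = ε / (4 * k) := ⟨_, rfl⟩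
  obtain ⟨α, hα⟩ : ∃ α : ℝ, α = ε / (2 * k * w) := ⟨_, rfl⟩
  have hδ0 : 0 < δ := by rw [hδ]; positivity
  have hα0 : 0 < α := by rw [hα]; positivity
  obtain ⟨B, hB⟩ : ∃ B : ℕ, B = ⌊Real.log (1 / α) / δ⌋₊ + 2 := ⟨_, rfl⟩
  have sg := fun x s l => segProd_stoch π M h0 h1 x s l
  have hle1 : ∀ x s l i i', segProd π M x s l i i' ≤ 1 := by
    intro x s l i i'
    rw [← (sg x s l).2 i]
    exact Finset.single_le_sum (f := fun j => segProd π M x s l i j)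
      (fun j _ => (sg x s l).1 i j) (Finset.mem_univ i')
  let code : (Fin n → Bool) → (Fin k → Fin w → Fin w → Fin B) := fun ρ p i i' =>
    ⟨cell α δ (segProd π M ρ (p * n) u i i'), by
      rw [hB]; exact cell_lt α δ _ hα0 hδ0 (hle1 _ _ _ _ _)⟩
  let G : (Fin n → Bool) → ((Fin n → Bool) → Bool) := fun ρ y => f (mix π u ρ y)
  have hη : (k : ℝ) * (2 * δ + w * α) = ε := by
    rw [hδ, hα]; field_simp; ring
  have hclose : ∀ ρ ρ', code ρ = code ρ' → ∀ y,
      f (mix π u ρ y) = true → f (mix π u ρ' y) = false → False := by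
    intro ρ ρ' hc y ht hf
    have hm := hybrid_main (k := k) π v0 M hv0 hv1 h0 h1 u hun ρ ρ' y (2 * δ + w * α) (by
      intro p hp i
      refine row_close α δ hα0 hδ0 _ _ ((sg _ _ _).1 i) ((sg _ _ _).1 i) ((sg _ _ _).2 i)
        ((sg _ _ _).2 i) ?_
      intro i'
      have := congrFun (congrFun (congrFun hc ⟨p, hp⟩) i) i'
      simpa [code] using this) k le_rfl
    rw [hη] at hm
    have e1 := hacc _ ht
    have e2 := hrej _ hf
    have e3 : ∑ i ∈ A, probDist π v0 M (mix π u ρ y) (k * n) i -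
        ∑ i ∈ A, probDist π v0 M (mix π u ρ' y) (k * n) i ≤ ε := by
      rw [← Finset.sum_sub_distrib]
      refine le_trans ?_ hm
      refine (Finset.sum_le_sum fun i _ => le_abs_self _).trans ?_
      exact Finset.sum_le_sum_of_subset_of_nonneg (Finset.subset_univ _)
        fun _ _ _ => abs_nonneg _
    linarith
  have hcount : subfunCount n f π u ≤ B ^ (k * w ^ 2) := by
    have hr := ncard_range_le_of_code G code (by
      intro ρ ρ' hc
      funext y
      show f (mix π u ρ y) = f (mix π u ρ' y)
      cases h : f (mix π u ρ y) <;> cases h' : f (mix π u ρ' y)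
      · rfl
      · exact (hclose ρ' ρ hc.symm y h' h).elim
      · exact (hclose ρ ρ' hc y h h').elim
      · rfl)
    have hset : { g : (Fin n → Bool) → Bool | ∃ ρ : Fin n → Bool,
        g = fun y => f (fun i => if ((π.symm i : Fin n) : ℕ) < u then ρ i else y i) } =
        Set.range G := by
      ext g
      constructor
      · rintro ⟨ρ, rfl⟩; exact ⟨ρ, rfl⟩
      · rintro ⟨ρ, rfl⟩; exact ⟨ρ, rfl⟩
    rw [subfunCount, hset]
    refine hr.trans (le_of_eq ?_)
    simp only [Fintype.card_pi, Fintype.card_fin, Finset.prod_const, Finset.card_univ]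
    rw [← pow_mul, ← pow_mul]
    congr 1
    ring
  have hlog : ∀ z : ℝ, 2 ≤ z → Real.log z ≤ Real.logb 2 z := by
    intro z hz
    rw [Real.logb, le_div_iff₀ (Real.log_pos (by norm_num))]
    have : Real.log 2 ≤ 1 := by linarith [Real.log_two_lt_d9]
    have hz0 : 0 ≤ Real.log z := Real.log_nonneg (by linarith)
    nlinarith
  have hBle : (B : ℝ) ≤ 4 / ε * k * (1 + Real.log (2 / ε) + Real.logb 2 w + Real.logb 2 k) := by
    have ea : 1 / α = (2 / ε) * w * k := by
      rw [hα]; field_simp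
    have el : Real.log (1 / α) = Real.log (2 / ε) + Real.log w + Real.log k := by
      rw [ea, Real.log_mul (by positivity) (by positivity),
        Real.log_mul (by positivity) (by positivity)]
    have lw := hlog w hwR
    have lk := hlog k hkR
    have lw0 : 0 ≤ Real.log w := Real.log_nonneg (by linarith)
    have lk0 : 0 ≤ Real.log k := Real.log_nonneg (by linarith)
    have ef : (⌊Real.log (1 / α) / δ⌋₊ : ℝ) ≤ Real.log (1 / α) / δ :=
      Nat.floor_le (div_nonneg (by rw [el]; linarith) hδ0.le)
    have ed : Real.log (1 / α) / δ =
        4 / ε * k * (Real.log (2 / ε) + Real.log w + Real.log k) := by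
      rw [el, hδ]; field_simp
    have ec : 2 ≤ 4 / ε * k := by
      rw [div_mul_eq_mul_div, le_div_iff₀ hε]; linarith
    have em : 4 / ε * k * (Real.log (2 / ε) + Real.log w + Real.log k) ≤
        4 / ε * k * (Real.log (2 / ε) + Real.logb 2 w + Real.logb 2 k) := by
      gcongr
    rw [hB]
    push_cast
    linarith [ef.trans_eq ed]
  have hB1 : (1 : ℝ) ≤ B := by
    have : 1 ≤ B := by omega
    exact_mod_cast this
  calc (subfunCount n f π u : ℝ) ≤ (B : ℝ) ^ (k * w ^ 2) := by exact_mod_cast hcount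
    _ ≤ (B : ℝ) ^ ((k + 1) * w ^ 2) := by
      apply pow_le_pow_right₀ hB1
      exact Nat.mul_le_mul_right _ (by omega)
    _ ≤ _ := by
      gcongr
end

section
/- For every ε with 0 < ε ≤ 1/2 there exists a constant C > 0 such that: if a Boolean function f : (Fin n → Bool) → Bool is computed with error at most 1/2 − ε by a quantum k-OBDD of width w ≥ 2 with order π, then N^π(f) ≤ w^(C·(k·w)²). -/
/-- The state vector of a quantum (k-)OBDD with order `π`, initial vector `ψ0` and
unitary transition matrices `G` after `t` steps on input `x`. -/
noncomputable def quantState {n w : ℕ} (π : Equiv.Perm (Fin n)) (ψ0 : Fin w → ℂ)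
    (G : ℕ → Bool → Matrix (Fin w) (Fin w) ℂ) (x : Fin n → Bool) : ℕ → Fin w → ℂ
  | 0 => ψ0
  | t + 1 => Matrix.mulVec (G t (readBit π x t)) (quantState π ψ0 G x t)

namespace KQ

noncomputable def nrm {w : ℕ} (v : Fin w → ℂ) : ℝ := ‖(WithLp.toLp 2 v : EuclideanSpace ℂ (Fin w))‖

theorem nrm_add {w : ℕ} (a b : Fin w → ℂ) : nrm (a + b) ≤ nrm a + nrm b := by
  unfold nrm
  rw [WithLp.toLp_add]
  exact norm_add_le _ _

theorem nrm_sq {w : ℕ} (v : Fin w → ℂ) : nrm v ^ 2 = ∑ i, Complex.normSq (v i) := by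
  unfold nrm
  rw [EuclideanSpace.norm_sq_eq]
  simp [Complex.normSq_eq_norm_sq]

theorem nrm_nonneg {w : ℕ} (v : Fin w → ℂ) : 0 ≤ nrm v := norm_nonneg _

theorem coord_le {w : ℕ} (v : Fin w → ℂ) (i : Fin w) : ‖v i‖ ≤ nrm v := by
  unfold nrm
  exact PiLp.norm_apply_le (p := 2) (WithLp.toLp 2 v : EuclideanSpace ℂ (Fin w)) i

theorem nrm_le_of_coord {w : ℕ} (v : Fin w → ℂ) (c : ℝ) (hc : 0 ≤ c) (h : ∀ i, ‖v i‖ ≤ c) :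
    nrm v ≤ w * c := by
  have h1 : nrm v ^ 2 ≤ (w * c) ^ 2 := by
    rw [nrm_sq]
    calc ∑ i, Complex.normSq (v i) ≤ ∑ i : Fin w, c ^ 2 := by
          apply Finset.sum_le_sum
          intro i _
          rw [Complex.normSq_eq_norm_sq]
          exact pow_le_pow_left₀ (norm_nonneg _) (h i) 2
      _ = w * c ^ 2 := by simp
      _ ≤ (w * c) ^ 2 := by
          rw [mul_pow]
          apply mul_le_mul_of_nonneg_right _ (sq_nonneg c)
          exact_mod_cast Nat.le_self_pow (by norm_num) w
  exact (sq_le_sq₀ (nrm_nonneg v) (by positivity)).1 h1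

theorem nrm_unitary {w : ℕ} (U : Matrix (Fin w) (Fin w) ℂ) (hU : U ∈ Matrix.unitaryGroup (Fin w) ℂ)
    (v : Fin w → ℂ) : nrm (U.mulVec v) = nrm v := by
  have key : ∀ z : Fin w → ℂ, ((nrm z ^ 2 : ℝ) : ℂ) = star z ⬝ᵥ z := by
    intro z
    rw [nrm_sq]
    simp [dotProduct, Complex.normSq_eq_conj_mul_self]
  have h2 : ((nrm (U.mulVec v) ^ 2 : ℝ) : ℂ) = ((nrm v ^ 2 : ℝ) : ℂ) := by
    rw [key, key, Matrix.star_mulVec, ← Matrix.dotProduct_mulVec, Matrix.mulVec_mulVec]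
    have : U.conjTranspose * U = 1 := Matrix.mem_unitaryGroup_iff'.1 hU
    rw [this, Matrix.one_mulVec]
  have h3 : nrm (U.mulVec v) ^ 2 = nrm v ^ 2 := by exact_mod_cast h2
  exact (pow_left_inj₀ (nrm_nonneg _) (nrm_nonneg _) (by norm_num)).1 h3

theorem nrm_mulVec_le {w : ℕ} (E : Matrix (Fin w) (Fin w) ℂ) (δ : ℝ) (hδ : 0 ≤ δ)
    (hE : ∀ i j, ‖E i j‖ ≤ δ) (v : Fin w → ℂ) : nrm (E.mulVec v) ≤ w * (w * (δ * nrm v)) := by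
  have := nrm_nonneg v
  apply nrm_le_of_coord _ _ (by positivity)
  intro i
  calc ‖E.mulVec v i‖ = ‖∑ j, E i j * v j‖ := rfl
    _ ≤ ∑ j, ‖E i j * v j‖ := norm_sum_le _ _
    _ ≤ ∑ j : Fin w, δ * nrm v := by
        apply Finset.sum_le_sum
        intro j _
        rw [norm_mul]
        exact mul_le_mul (hE i j) (coord_le v j) (norm_nonneg _) hδ
    _ = _ := by simp

theorem acc_diff {w : ℕ} (A : Finset (Fin w)) (a b : Fin w → ℂ) (ha : nrm a = 1) (hb : nrm b = 1) :
    ∑ i ∈ A, Complex.normSq (a i) - ∑ i ∈ A, Complex.normSq (b i) ≤ w * (2 * nrm (a - b)) := by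
  have h0 := nrm_nonneg (a - b)
  rw [← Finset.sum_sub_distrib]
  calc _ ≤ ∑ i ∈ A, 2 * nrm (a - b) := by
        apply Finset.sum_le_sum
        intro i _
        rw [Complex.normSq_eq_norm_sq, Complex.normSq_eq_norm_sq]
        have h1 := coord_le a i
        have h2 := coord_le b i
        have h3 := coord_le (a - b) i
        have h4 : ‖a i‖ - ‖b i‖ ≤ ‖(a - b) i‖ := norm_sub_norm_le _ _
        have h5 := norm_nonneg (a i)
        have h6 := norm_nonneg (b i)
        rw [ha] at h1
        rw [hb] at h2
        nlinarith
    _ = A.card * (2 * nrm (a - b)) := by simp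
    _ ≤ _ := by
        apply mul_le_mul_of_nonneg_right _ (by positivity)
        have := Finset.card_le_univ A
        simp at this
        exact_mod_cast this

noncomputable def blk {n w : ℕ} (π : Equiv.Perm (Fin n))
    (G : ℕ → Bool → Matrix (Fin w) (Fin w) ℂ) (x : Fin n → Bool) (a : ℕ) :
    ℕ → Matrix (Fin w) (Fin w) ℂ
  | 0 => 1
  | m + 1 => G (a + m) (readBit π x (a + m)) * blk π G x a m

section
variable {n w : ℕ} (π : Equiv.Perm (Fin n)) (ψ0 : Fin w → ℂ)
  (G : ℕ → Bool → Matrix (Fin w) (Fin w) ℂ)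

theorem state_blk (x : Fin n → Bool) (a m : ℕ) :
    quantState π ψ0 G x (a + m) = (blk π G x a m).mulVec (quantState π ψ0 G x a) := by
  induction m with
  | zero => simp [blk]
  | succ m ih =>
    rw [← add_assoc, quantState, ih, blk, Matrix.mulVec_mulVec]

theorem blk_unitary (hG : ∀ j b, G j b ∈ Matrix.unitaryGroup (Fin w) ℂ) (x : Fin n → Bool)
    (a m : ℕ) : blk π G x a m ∈ Matrix.unitaryGroup (Fin w) ℂ := by
  induction m with
  | zero => exact one_mem _
  | succ m ih => exact mul_mem (hG _ _) ih

theorem state_norm (hG : ∀ j b, G j b ∈ Matrix.unitaryGroup (Fin w) ℂ) (x : Fin n → Bool)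
    (hψ : nrm ψ0 = 1) (t : ℕ) : nrm (quantState π ψ0 G x t) = 1 := by
  have := state_blk π ψ0 G x 0 t
  rw [zero_add] at this
  rw [this, nrm_unitary _ (blk_unitary π G hG x 0 t)]
  exact hψ

theorem blk_congr (x x' : Fin n → Bool) (a m : ℕ)
    (h : ∀ s < m, readBit π x (a + s) = readBit π x' (a + s)) :
    blk π G x a m = blk π G x' a m := by
  induction m with
  | zero => rfl
  | succ m ih =>
    rw [blk, blk, ih (fun s hs => h s (by omega)), h m (by omega)]

/-- merged input -/
def mrg (u : ℕ) (ρ y : Fin n → Bool) : Fin n → Bool :=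
  fun i => if ((π.symm i : Fin n) : ℕ) < u then ρ i else y i

theorem readBit_mrg_lt (u : ℕ) (hu : u < n) (ρ y : Fin n → Bool) (i s : ℕ) (hs : s < u) :
    readBit π (mrg π u ρ y) (i * n + s) = readBit π ρ (i * n + s) := by
  have hn : 0 < n := by omega
  have hm : (i * n + s) % n = s := by
    rw [Nat.mul_add_mod_self_right]; exact Nat.mod_eq_of_lt (by omega)
  simp [readBit, mrg, hn, hm, hs]

theorem readBit_mrg_ge (u : ℕ) (hu : u < n) (ρ y : Fin n → Bool) (i s : ℕ) (hs : u ≤ s)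
    (hsn : s < n) :
    readBit π (mrg π u ρ y) (i * n + s) = readBit π y (i * n + s) := by
  have hn : 0 < n := by omega
  have hm : (i * n + s) % n = s := by
    rw [Nat.mul_add_mod_self_right]; exact Nat.mod_eq_of_lt (by omega)
  simp [readBit, mrg, hn, hm, hs]

theorem pass_step (hG : ∀ j b, G j b ∈ Matrix.unitaryGroup (Fin w) ℂ)
    (hψ : nrm ψ0 = 1) (u : ℕ) (hu : u < n) (ρ ρ' y : Fin n → Bool) (i : ℕ) (δ : ℝ) (hδ : 0 ≤ δ)
    (h : ∀ p q, ‖blk π G ρ (i * n) u p q - blk π G ρ' (i * n) u p q‖ ≤ δ) :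
    nrm (quantState π ψ0 G (mrg π u ρ y) ((i + 1) * n)
        - quantState π ψ0 G (mrg π u ρ' y) ((i + 1) * n))
      ≤ nrm (quantState π ψ0 G (mrg π u ρ y) (i * n)
        - quantState π ψ0 G (mrg π u ρ' y) (i * n)) + w * (w * δ) := by
  have e : (i + 1) * n = (i * n + u) + (n - u) := by
    rw [add_mul]; omega
  have hA : ∀ σ, blk π G (mrg π u σ y) (i * n) u = blk π G σ (i * n) u := fun σ =>
    blk_congr π G _ _ _ _ (fun s hs => readBit_mrg_lt π u hu σ y i s hs)
  have hB : ∀ σ, blk π G (mrg π u σ y) (i * n + u) (n - u) = blk π G y (i * n + u) (n - u) :=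
    fun σ => blk_congr π G _ _ _ _ (fun s hs => by
      rw [add_assoc]
      exact readBit_mrg_ge π u hu σ y i (u + s) (by omega) (by omega))
  rw [e, state_blk π ψ0 G _ (i * n + u) (n - u), state_blk π ψ0 G (mrg π u ρ' y) (i * n + u) (n - u), hB, hB, ← Matrix.mulVec_sub,
    nrm_unitary _ (blk_unitary π G hG _ _ _),
    state_blk π ψ0 G _ (i * n) u, state_blk π ψ0 G (mrg π u ρ' y) (i * n) u, hA, hA]
  set s := quantState π ψ0 G (mrg π u ρ y) (i * n)
  set s' := quantState π ψ0 G (mrg π u ρ' y) (i * n) with hs'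
  set W := blk π G ρ (i * n) u with hW
  set W' := blk π G ρ' (i * n) u
  have e2 : W.mulVec s - W'.mulVec s' = W.mulVec (s - s') + (W - W').mulVec s' := by
    rw [Matrix.mulVec_sub, Matrix.sub_mulVec]; abel
  rw [e2]
  refine (nrm_add _ _).trans (add_le_add ?_ ?_)
  · rw [nrm_unitary _ (hW ▸ blk_unitary π G hG _ _ _)]
  · have := nrm_mulVec_le (W - W') δ hδ h s'
    rwa [hs', state_norm π ψ0 G hG _ hψ, mul_one] at this

theorem total (hG : ∀ j b, G j b ∈ Matrix.unitaryGroup (Fin w) ℂ)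
    (hψ : nrm ψ0 = 1) (u : ℕ) (hu : u < n) (ρ ρ' y : Fin n → Bool) (k : ℕ) (δ : ℝ) (hδ : 0 ≤ δ)
    (h : ∀ i < k, ∀ p q, ‖blk π G ρ (i * n) u p q - blk π G ρ' (i * n) u p q‖ ≤ δ) :
    nrm (quantState π ψ0 G (mrg π u ρ y) (k * n)
        - quantState π ψ0 G (mrg π u ρ' y) (k * n)) ≤ k * (w * (w * δ)) := by
  induction k with
  | zero => simp [quantState, nrm]
  | succ k ih =>
    have h1 := pass_step π ψ0 G hG hψ u hu ρ ρ' y k δ hδ (h k (by omega))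
    have h2 := ih (fun i hi => h i (by omega))
    push_cast
    linarith

end

theorem floor_mem (M : ℕ) (r : ℝ) (hr : |r| ≤ 1) : ⌊(M : ℝ) * r⌋ ∈ Finset.Icc (-(M : ℤ)) M := by
  have := abs_le.1 hr
  have hM : (0 : ℝ) ≤ M := by positivity
  rw [Finset.mem_Icc]
  constructor
  · rw [Int.le_floor]; push_cast; nlinarith
  · have : ((⌊(M : ℝ) * r⌋ : ℤ) : ℝ) ≤ ((M : ℤ) : ℝ) := (Int.floor_le _).trans (by push_cast; nlinarith)
    exact_mod_cast this

theorem floor_close (M : ℕ) (hM : 0 < M) (r s : ℝ) (h : ⌊(M : ℝ) * r⌋ = ⌊(M : ℝ) * s⌋) :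
    |r - s| ≤ 1 / M := by
  have h1 := Int.abs_sub_lt_one_of_floor_eq_floor h
  have hM' : (0 : ℝ) < M := by exact_mod_cast hM
  rw [← mul_sub, abs_mul, abs_of_pos hM'] at h1
  rw [le_div_iff₀ hM']
  linarith

/-- counting via a fingerprint -/
theorem count_le {α β T : Type*} [Fintype T] [Nonempty β] (F : α → β) (q : α → T)
    (h : ∀ a b, q a = q b → F a = F b) : (Set.range F).ncard ≤ Fintype.card T := by
  classical
  let g : T → β := Function.extend q F (fun _ => Classical.arbitrary β)
  have hsub : Set.range F ⊆ g '' Set.univ := by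
    rintro _ ⟨a, rfl⟩
    refine ⟨q a, trivial, ?_⟩
    exact Function.FactorsThrough.extend_apply (fun a b hab => h a b hab) _ a
  calc _ ≤ (g '' Set.univ).ncard := Set.ncard_le_ncard hsub (Set.toFinite _)
    _ ≤ (Set.univ : Set T).ncard := Set.ncard_image_le
    _ = _ := by rw [Set.ncard_univ, Nat.card_eq_fintype_card]

end KQ

/-- For every `ε ∈ (0, 1/2]` there is a constant `C > 0` such that: if `f` is computed
with error at most `1/2 - ε` by a quantum `k`-OBDD of width `w ≥ 2` with order `π`,
then `N^π(f) ≤ w^(C·(k·w)²)`. -/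
theorem quantum_kOBDD_subfunction_bound :
    ∀ ε : ℝ, 0 < ε → ε ≤ 1 / 2 →
    ∃ C : ℝ, 0 < C ∧
      ∀ (n k w : ℕ) (f : (Fin n → Bool) → Bool) (π : Equiv.Perm (Fin n))
        (ψ0 : Fin w → ℂ) (G : ℕ → Bool → Matrix (Fin w) (Fin w) ℂ) (A : Finset (Fin w)),
        2 ≤ w →
        (∑ i, Complex.normSq (ψ0 i)) = 1 →
        (∀ j b, G j b ∈ Matrix.unitaryGroup (Fin w) ℂ) →
        (∀ x, f x = true →
          1 / 2 + ε ≤ ∑ i ∈ A, Complex.normSq (quantState π ψ0 G x (k * n) i)) →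
        (∀ x, f x = false →
          ∑ i ∈ A, Complex.normSq (quantState π ψ0 G x (k * n) i) ≤ 1 / 2 - ε) →
        ∀ u : ℕ, 1 ≤ u → u < n →
          (subfunCount n f π u : ℝ) ≤ (w : ℝ) ^ (C * ((k : ℝ) * w) ^ 2) := by
  intro ε hε hε2
  obtain ⟨L, hL⟩ : ∃ L : ℕ, 4 / ε < 2 ^ L := pow_unbounded_of_one_lt _ (by norm_num)
  refine ⟨2 * (L + 6), by positivity, ?_⟩
  intro n k w f π ψ0 G A hw hψ hG hT hF u hu1 hun
  have hψ1 : KQ.nrm ψ0 = 1 := by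
    have := KQ.nrm_sq ψ0
    rw [hψ] at this
    exact (pow_eq_one_iff_of_nonneg (KQ.nrm_nonneg _) (by norm_num)).1 this
  set M : ℕ := 2 ^ L * k * w ^ 3 with hM
  let F : (Fin n → Bool) → ((Fin n → Bool) → Bool) := fun ρ y => f (KQ.mrg π u ρ y)
  have hcount : subfunCount n f π u = (Set.range F).ncard := by
    unfold subfunCount
    congr 1
    ext g
    constructor
    · rintro ⟨ρ, rfl⟩; exact ⟨ρ, rfl⟩
    · rintro ⟨ρ, rfl⟩; exact ⟨ρ, rfl⟩
  have hent : ∀ ρ a p q, ‖KQ.blk π G ρ a u p q‖ ≤ 1 := fun ρ a p q =>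
    entry_norm_bound_of_unitary (KQ.blk_unitary π G hG ρ a u) p q
  let Q : (Fin n → Bool) → (Fin k × Fin w × Fin w → 
      (Finset.Icc (-(M : ℤ)) M) × (Finset.Icc (-(M : ℤ)) M)) := fun ρ t =>
    (⟨⌊(M : ℝ) * (KQ.blk π G ρ (t.1 * n) u t.2.1 t.2.2).re⌋,
        KQ.floor_mem M _ ((Complex.abs_re_le_norm _).trans (hent _ _ _ _))⟩,
     ⟨⌊(M : ℝ) * (KQ.blk π G ρ (t.1 * n) u t.2.1 t.2.2).im⌋,
        KQ.floor_mem M _ ((Complex.abs_im_le_norm _).trans (hent _ _ _ _))⟩)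
  have hQ : ∀ ρ ρ', Q ρ = Q ρ' → F ρ = F ρ' := by
    intro ρ ρ' hq
    funext y
    -- distance of the final states
    have hdist : ∀ σ σ', Q σ = Q σ' → ∑ i ∈ A, Complex.normSq (quantState π ψ0 G (KQ.mrg π u σ y) (k * n) i)
        - ∑ i ∈ A, Complex.normSq (quantState π ψ0 G (KQ.mrg π u σ' y) (k * n) i) < 2 * ε := by
      intro σ σ' hq
      have h1 := KQ.acc_diff A _ _ (KQ.state_norm π ψ0 G hG (KQ.mrg π u σ y) hψ1 (k * n))
        (KQ.state_norm π ψ0 G hG (KQ.mrg π u σ' y) hψ1 (k * n))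
      have h2 := KQ.total π ψ0 G hG hψ1 u hun σ σ' y k (2 / M) (by positivity) (by
        intro i hi p q
        have hMpos : 0 < M := by rw [hM]; have : 0 < k := by omega
                                 positivity
        have ht := congrFun hq (⟨i, hi⟩, p, q)
        simp only [Q, Prod.mk.injEq, Subtype.mk.injEq] at ht
        have hr := KQ.floor_close M hMpos _ _ ht.1
        have hi := KQ.floor_close M hMpos _ _ ht.2
        have hc := Complex.norm_le_abs_re_add_abs_im
          (KQ.blk π G σ (i * n) u p q - KQ.blk π G σ' (i * n) u p q)
        rw [Complex.sub_re, Complex.sub_im] at hc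
        have : (2 : ℝ) / M = 1 / M + 1 / M := by ring
        linarith)
      refine h1.trans_lt ?_
      have hw0 : (0 : ℝ) < w := by exact_mod_cast (by omega : 0 < w)
      refine lt_of_le_of_lt (mul_le_mul_of_nonneg_left (mul_le_mul_of_nonneg_left h2 (by norm_num)) hw0.le) ?_
      rcases Nat.eq_zero_or_pos k with hk | hk
      · subst hk; simp; exact hε
      · have hk0 : (0 : ℝ) < k := by exact_mod_cast hk
        have e : (w : ℝ) * (2 * (k * (w * (w * (2 / (M : ℝ)))))) = 4 / 2 ^ L := by
          rw [hM]; push_cast; field_simp; norm_num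
        rw [e, div_lt_iff₀ (by positivity)]
        rw [div_lt_iff₀ hε] at hL
        nlinarith [pow_pos (two_pos : (0:ℝ) < 2) L]
    have ha := hdist ρ ρ' hq
    have hb := hdist ρ' ρ hq.symm
    show f (KQ.mrg π u ρ y) = f (KQ.mrg π u ρ' y)
    cases h1 : f (KQ.mrg π u ρ y) <;> cases h2 : f (KQ.mrg π u ρ' y)
    · rfl
    · have := hF _ h1; have := hT _ h2; linarith
    · have := hT _ h1; have := hF _ h2; linarith
    · rfl
  have hc := KQ.count_le F Q hQ
  rw [← hcount] at hc
  have hcard : Fintype.card (Fin k × Fin w × Fin w → 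
      (Finset.Icc (-(M : ℤ)) M) × (Finset.Icc (-(M : ℤ)) M)) = (2 * M + 1) ^ (2 * (k * (w * w))) := by
    have h0 : ((M : ℤ) + 1 - (-(M : ℤ))).toNat = 2 * M + 1 := by omega
    rw [Fintype.card_fun, Fintype.card_prod, Fintype.card_coe, Int.card_Icc, h0, pow_mul]
    simp [sq]
  rw [hcard] at hc
  have hfin : (2 * M + 1) ^ (2 * (k * (w * w))) ≤ w ^ (2 * (L + 6) * (k * w) ^ 2) := by
    rcases Nat.eq_zero_or_pos k with hk | hk
    · subst hk; simp
    · have h1 : 2 * M + 1 ≤ w ^ ((L + 6) * k) := by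
        have hMpos : 0 < M := by rw [hM]; positivity
        have hk2 : k ≤ 2 ^ k := Nat.lt_two_pow_self.le
        calc 2 * M + 1 ≤ 2 ^ 2 * M := by omega
          _ = 2 ^ (L + 2) * k * w ^ 3 := by rw [hM]; ring
          _ ≤ 2 ^ (L + 2) * 2 ^ k * w ^ 3 := by gcongr
          _ ≤ w ^ (L + 2) * w ^ k * w ^ 3 := by gcongr
          _ = w ^ (L + 2 + k + 3) := by ring
          _ ≤ _ := by
            apply Nat.pow_le_pow_right (by omega)
            nlinarith
      calc _ ≤ (w ^ ((L + 6) * k)) ^ (2 * (k * (w * w))) := Nat.pow_le_pow_left h1 _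
        _ = _ := by rw [← pow_mul]; congr 1; ring
  have hfinal : (subfunCount n f π u : ℝ) ≤ (w : ℝ) ^ (2 * (L + 6) * (k * w) ^ 2 : ℕ) := by
    exact_mod_cast hc.trans hfin
  refine hfinal.trans (le_of_eq ?_)
  rw [← Real.rpow_natCast]
  congr 1
  push_cast
  ring
end

section
/- For all integers k ≥ 2, w ≥ 64 and n with 2·k·w·(2·w + ⌈log₂ k⌉ + ⌈log₂ (2·w)⌉) < n, there exists a Boolean function f : (Fin n → Bool) → Bool that is computed by some deterministic k-OBDD of width w with some order π, but is not computed by any deterministic k-OBDD of width ⌊w/16⌋ − 3 with any order. -/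
/-- `f` is computed by some deterministic `k`-OBDD of width `w` on `n` variables
(with some order `π`). -/
def detComputes (k w n : ℕ) (f : (Fin n → Bool) → Bool) : Prop :=
  ∃ (π : Equiv.Perm (Fin n)) (s : Fin w) (δ : ℕ → Fin w → Bool → Fin w)
    (A : Finset (Fin w)),
    ∀ x : Fin n → Bool, detState π s δ x (k * n) ∈ A ↔ f x = true

/-! ## Restricting a program to the first `m` variables -/

/-- Run a reduced program on `m` variables with variable order `τ` for `a` steps. -/
def redRun {k m v : ℕ} (hm : 0 < m) (τ : Fin m → Fin m) (s : Fin v)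
    (G : Fin (k * m) → Fin v → Bool → Fin v) (y : Fin m → Bool) : ℕ → Fin v
  | 0 => s
  | a + 1 => if h : a < k * m then
      G ⟨a, h⟩ (redRun hm τ s G y a) (y (τ ⟨a % m, Nat.mod_lt a hm⟩))
    else redRun hm τ s G y a

/-- Extend an assignment of the first `m` variables by `false`. -/
def extInput {m n : ℕ} (y : Fin m → Bool) : Fin n → Bool :=
  fun p => if h : p.val < m then y ⟨p.val, h⟩ else false

/-- Run `d` steps from time `t` reading only `false`. -/
def zeroRun {v : ℕ} (δ : ℕ → Fin v → Bool → Fin v) (t : ℕ) (q : Fin v) : ℕ → Fin v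
  | 0 => q
  | d + 1 => δ (t + d) (zeroRun δ t q d) false

theorem detState_zeroRun {n v : ℕ} (π : Equiv.Perm (Fin n)) (s : Fin v)
    (δ : ℕ → Fin v → Bool → Fin v) (x : Fin n → Bool) (t d : ℕ)
    (h : ∀ u, t ≤ u → u < t + d → readBit π x u = false) :
    detState π s δ x (t + d) = zeroRun δ t (detState π s δ x t) d := by
  induction d with
  | zero => rfl
  | succ d ih =>
    have h1 := ih (fun u hu hu' => h u hu (by omega))
    have h2 := h (t + d) (by omega) (by omega)
    show δ (t + d) (detState π s δ x (t + d)) (readBit π x (t + d)) = _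
    rw [h1, h2]
    rfl

theorem restrict_program {k m n v : ℕ} (hm : 0 < m) (hmn : m ≤ n)
    (π : Equiv.Perm (Fin n)) (s : Fin v)
    (δ : ℕ → Fin v → Bool → Fin v) (A : Finset (Fin v)) :
    ∃ (τ : Fin m → Fin m) (G : Fin (k * m) → Fin v → Bool → Fin v) (A' : Finset (Fin v)),
      ∀ y : Fin m → Bool, detState π s δ (extInput y) (k * n) ∈ A ↔
        redRun hm τ s G y (k * m) ∈ A' := by
  classical
  have hn : 0 < n := by omega
  let S : Finset (Fin n) := Finset.univ.filter (fun t => (π t).val < m)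
  have hS : S.card = m := by
    have h1 : S = (Finset.univ.filter (fun t : Fin n => t.val < m)).map π.symm.toEmbedding := by
      ext t
      simp [S, Finset.mem_map_equiv]
    rw [h1, Finset.card_map]
    have h2 := Fin.card_filter_val_lt (n := n) (m := m)
    rw [h2]; omega
  let p : Fin m ↪o Fin n := S.orderEmbOfFin hS
  have hp : ∀ j, (π (p j)).val < m := fun j => by
    have := S.orderEmbOfFin_mem hS j
    exact (Finset.mem_filter.1 this).2
  have hps : ∀ t : Fin n, (π t).val < m → ∃ j, p j = t := fun t ht => by
    have h1 : t ∈ Set.range (S.orderEmbOfFin hS) := by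
      rw [Finset.range_orderEmbOfFin]
      simp [S, ht]
    exact h1
  let τ : Fin m → Fin m := fun j => ⟨π (p j), hp j⟩
  let θ : ℕ → ℕ := fun a => n * (a / m) + (p ⟨a % m, Nat.mod_lt a hm⟩).val
  have hθdiv : ∀ a, θ a / n = a / m := fun a => by
    show (n * (a / m) + _) / n = _
    rw [Nat.mul_add_div hn, Nat.div_eq_of_lt (Fin.is_lt _)]; simp
  have hθmod : ∀ a, θ a % n = (p ⟨a % m, Nat.mod_lt a hm⟩).val := fun a => by
    show (n * (a / m) + _) % n = _
    rw [Nat.mul_add_mod, Nat.mod_eq_of_lt (Fin.is_lt _)]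
  have hmono : StrictMono θ := by
    intro a b hab
    have h1 : a / m ≤ b / m := Nat.div_le_div_right hab.le
    rcases h1.lt_or_eq with h | h
    · show n * (a / m) + _ < n * (b / m) + _
      have h2 : n * (a / m + 1) ≤ n * (b / m) := Nat.mul_le_mul_left _ h
      have h3 := (p ⟨a % m, Nat.mod_lt a hm⟩).is_lt
      rw [Nat.mul_add] at h2
      omega
    · have h2 : a % m < b % m := by
        have ha := Nat.div_add_mod a m
        have hb := Nat.div_add_mod b m
        rw [h] at ha
        omega
      have h3 : p ⟨a % m, Nat.mod_lt a hm⟩ < p ⟨b % m, Nat.mod_lt b hm⟩ := by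
        rw [p.lt_iff_lt]; exact h2
      have h4 : (p ⟨a % m, Nat.mod_lt a hm⟩).val < (p ⟨b % m, Nat.mod_lt b hm⟩).val := h3
      show n * (a / m) + _ < n * (b / m) + _
      rw [h]; omega
  have hbit : ∀ (y : Fin m → Bool) a,
      readBit π (extInput y) (θ a) = y (τ ⟨a % m, Nat.mod_lt a hm⟩) := by
    intro y a
    have h1 : (⟨θ a % n, Nat.mod_lt _ hn⟩ : Fin n) = p ⟨a % m, Nat.mod_lt a hm⟩ :=
      Fin.ext (hθmod a)
    simp only [readBit, hn, dite_true, h1, extInput, hp, τ]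
  have hzero : ∀ (y : Fin m → Bool) t, (∀ b, θ b ≠ t) → readBit π (extInput y) t = false := by
    intro y t ht
    simp only [readBit, hn, dite_true, extInput]
    split_ifs with h
    · exfalso
      obtain ⟨j, hj⟩ := hps _ h
      apply ht (m * (t / n) + j.val)
      have e1 : (m * (t / n) + j.val) / m = t / n := by
        rw [Nat.mul_add_div hm, Nat.div_eq_of_lt j.is_lt]; simp
      have e2 : (m * (t / n) + j.val) % m = j.val := by
        rw [Nat.mul_add_mod, Nat.mod_eq_of_lt j.is_lt]
      show n * _ + _ = _
      have e3 : (⟨(m * (t / n) + j.val) % m, Nat.mod_lt _ hm⟩ : Fin m) = j := Fin.ext e2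
      rw [e1, e3, hj]
      exact Nat.div_add_mod t n
    · rfl
  let E : ℕ → ℕ := fun a => match a with
    | 0 => 0
    | a + 1 => θ a + 1
  have hEle : ∀ a, E a ≤ θ a := by
    intro a
    cases a with
    | zero => exact Nat.zero_le _
    | succ a => exact hmono (Nat.lt_succ_self a)
  have hgap : ∀ (y : Fin m → Bool) a t, E a ≤ t → t < θ a →
      readBit π (extInput y) t = false := by
    intro y a t h1 h2
    apply hzero
    intro b hb
    subst hb
    have h3 : b < a := hmono.lt_iff_lt.1 h2
    cases a with
    | zero => omega
    | succ a =>
      have h4 : θ b ≤ θ a := hmono.monotone (by omega)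
      have h5 : θ a + 1 ≤ θ b := h1
      omega
  have hEk : E (k * m) ≤ k * n := by
    rcases hkm : k * m with _ | a
    · exact Nat.zero_le _
    · show θ a + 1 ≤ k * n
      have h1 : θ a / n < k := by
        rw [hθdiv, Nat.div_lt_iff_lt_mul hm]; omega
      rw [Nat.div_lt_iff_lt_mul hn] at h1
      exact h1
  have hθk : k * n ≤ θ (k * m) := by
    have h1 : θ (k * m) / n = k := by rw [hθdiv, Nat.mul_div_cancel _ hm]
    have h2 := Nat.div_mul_le_self (θ (k * m)) n
    rwa [h1] at h2
  let G : Fin (k * m) → Fin v → Bool → Fin v := fun a q b =>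
    δ (θ a) (zeroRun δ (E a) q (θ a - E a)) b
  refine ⟨τ, G, Finset.univ.filter
    (fun q => zeroRun δ (E (k * m)) q (k * n - E (k * m)) ∈ A), ?_⟩
  intro y
  have key : ∀ a, a ≤ k * m → redRun hm τ s G y a = detState π s δ (extInput y) (E a) := by
    intro a
    induction a with
    | zero => intro _; rfl
    | succ a ih =>
      intro ha
      have ha' : a < k * m := by omega
      have h1 := ih (by omega)
      have h2 := detState_zeroRun π s δ (extInput y) (E a) (θ a - E a)
        (fun u hu hu' => hgap y a u hu (by omega))
      have h3 : E a + (θ a - E a) = θ a := by have := hEle a; omega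
      rw [h3] at h2
      show _ = δ (θ a) (detState π s δ (extInput y) (θ a)) (readBit π (extInput y) (θ a))
      rw [h2, hbit]
      simp only [redRun, ha', dite_true, h1, G]
  have h2 := detState_zeroRun π s δ (extInput y) (E (k * m)) (k * n - E (k * m))
        (fun u hu hu' => hgap y (k * m) u hu (by omega))
  have h3 : E (k * m) + (k * n - E (k * m)) = k * n := by omega
  rw [h3] at h2
  rw [h2, ← key _ le_rfl]
  simp

/-! ## The family of wide programs -/

/-- Natural number version of the table `T`. -/
def tabN {k M W : ℕ} (T : Fin k → Fin M → Fin W → Fin W) (i l q : ℕ) : ℕ :=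
  if h : i < k ∧ l < M ∧ q < W then (T ⟨i, h.1⟩ ⟨l, h.2.1⟩ ⟨q, h.2.2⟩).val else 0

/-- Action of a `true` bit. State `W` is the accepting sink, `W + 1` the idle state. -/
def stepN {k M W : ℕ} (T : Fin k → Fin M → Fin W → Fin W) (i pos s : ℕ) : ℕ :=
  if pos < k * W then (if pos / W = i ∧ s = W + 1 then pos % W else s)
  else if pos < k * W + M then (if s < W then tabN T i (pos - k * W) s else s)
  else if pos < k * W + M + W then
    (if s < W then (if s = pos - k * W - M then W else W + 1) else s)
  else s

/-- Transition functions of the wide program. -/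
def bigδ {k M W : ℕ} (T : Fin k → Fin M → Fin W → Fin W) (n : ℕ) :
    ℕ → Fin (W + 2) → Bool → Fin (W + 2) := fun t s b =>
  if b = true then
    (if h : stepN T (t / n) (t % n) s.val < W + 2 then ⟨_, h⟩ else s) else s

/-- The probing input. -/
def probe (m a b c : ℕ) : Fin m → Bool := fun p => decide (p.val = a ∨ p.val = b ∨ p.val = c)

set_option maxHeartbeats 2000000 in
theorem big_run {k M W n : ℕ} (T : Fin k → Fin M → Fin W → Fin W)
    (hn : k * W + M + W ≤ n) (i : Fin k) (l : Fin M) (q r : Fin W) (t : ℕ) :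
    (detState (Equiv.refl (Fin n)) ⟨W + 1, by omega⟩ (bigδ T n)
      (extInput (probe (k * W + M + W) (i * W + q) (k * W + l) (k * W + M + r))) t).val =
    if t ≤ n * i + (i * W + q) then W + 1
    else if t ≤ n * i + (k * W + l) then q.val
    else if t ≤ n * i + (k * W + M + r) then (T i l q).val
    else if T i l q = r then W else W + 1 := by
  have hiW : i.val * W + q.val < k * W := by
    have h1 : (i.val + 1) * W ≤ k * W := Nat.mul_le_mul_right _ i.is_lt
    have := q.is_lt
    rw [Nat.add_mul] at h1
    omega
  have hl := l.is_lt
  have hr := r.is_lt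
  have hq := q.is_lt
  have hTl := (T i l q).is_lt
  have hWpos : 0 < W := by omega
  have hnpos : 0 < n := by omega
  induction t with
  | zero => simp [detState]
  | succ t ih =>
    have hbit : readBit (Equiv.refl (Fin n)) (extInput (probe (k * W + M + W) (i * W + q)
        (k * W + l) (k * W + M + r))) t =
        decide (t % n = i * W + q ∨ t % n = k * W + l ∨ t % n = k * W + M + r) := by
      unfold readBit
      rw [dif_pos hnpos]
      unfold extInput
      by_cases h : ((Equiv.refl (Fin n)) ⟨t % n, Nat.mod_lt t hnpos⟩).val < k * W + M + W
      · rw [dif_pos h]; rfl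
      · rw [dif_neg h]; symm; rw [decide_eq_false_iff_not]
        have h' : ¬ t % n < k * W + M + W := h
        omega
    have hdm := Nat.div_add_mod t n
    have hml := Nat.mod_lt t hnpos
    show (bigδ T n t (detState _ _ _ _ t) (readBit _ _ t)).val = _
    rw [hbit]
    generalize detState _ _ _ _ t = st at ih
    -- compare the pass with `i`
    have hpass : (t / n < i.val ∧ n * (t / n) + n ≤ n * i.val) ∨ (t / n = i.val ∧
        n * (t / n) = n * i.val) ∨ (i.val < t / n ∧ n * i.val + n ≤ n * (t / n)) := by
      rcases lt_trichotomy (t / n) i.val with h | h | h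
      · left
        exact ⟨h, by have := Nat.mul_le_mul_left n (Nat.succ_le_of_lt h); rwa [Nat.mul_succ] at this⟩
      · right; left; exact ⟨h, by rw [h]⟩
      · right; right
        exact ⟨h, by have := Nat.mul_le_mul_left n (Nat.succ_le_of_lt h); rwa [Nat.mul_succ] at this⟩
    have hstw := st.is_lt
    have hdiv1 : (i.val * W + q.val) / W = i.val := by
      rw [Nat.mul_comm, Nat.mul_add_div hWpos, Nat.div_eq_of_lt hq]; simp
    have hmod1 : (i.val * W + q.val) % W = q.val := by
      rw [Nat.mul_comm, Nat.mul_add_mod, Nat.mod_eq_of_lt hq]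
    have htab : tabN T i.val l.val q.val = (T i l q).val := by
      simp [tabN]
    have hTr : T i l q = r ↔ (T i l q).val = r.val := Fin.ext_iff
    -- the value after the step
    have hval : ∀ b : Bool, stepN T (t / n) (t % n) st.val < W + 2 →
        (bigδ T n t st b).val = if b = true then stepN T (t / n) (t % n) st.val else st.val := by
      intro b hb
      unfold bigδ
      cases b <;> simp [hb]
    by_cases hb : t % n = i * W + q ∨ t % n = k * W + l ∨ t % n = k * W + M + r
    · have hstep : stepN T (t / n) (t % n) st.val =
          if t + 1 ≤ n * i + (i * W + q) then W + 1
          else if t + 1 ≤ n * i + (k * W + l) then q.val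
          else if t + 1 ≤ n * i + (k * W + M + r) then (T i l q).val
          else if T i l q = r then W else W + 1 := by
        rcases hb with hb | hb | hb
        · rw [hb] at hdm
          unfold stepN
          rw [hb, if_pos hiW, hdiv1, hmod1]
          rcases hpass with h | h | h
          · rw [if_pos (by omega)] at ih
            rw [if_neg (by omega), ih, if_pos (by omega)]
          · rw [if_pos (by omega)] at ih
            rw [if_pos (by omega), if_neg (by omega), if_pos (by omega)]
          · rw [if_neg (by omega), if_neg (by omega), if_neg (by omega)] at ih
            have h5 : ¬ (i.val = t / n ∧ st.val = W + 1) := by omega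
            rw [if_neg h5, if_neg (by omega), if_neg (by omega), if_neg (by omega)]
            exact ih
        · rw [hb] at hdm
          unfold stepN
          rw [hb, if_neg (by omega), if_pos (by omega)]
          have e : k * W + l.val - k * W = l.val := by omega
          rw [e]
          rcases hpass with h | h | h
          · rw [if_pos (by omega)] at ih
            rw [if_neg (by omega), ih, if_pos (by omega)]
          · rw [if_neg (by omega), if_pos (by omega)] at ih
            rw [h.1, ih, if_pos hq, htab, if_neg (by omega), if_neg (by omega), if_pos (by omega)]
          · rw [if_neg (by omega), if_neg (by omega), if_neg (by omega)] at ih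
            have h5 : ¬ st.val < W := by rw [ih]; split_ifs <;> omega
            rw [if_neg h5, if_neg (by omega), if_neg (by omega), if_neg (by omega)]
            exact ih
        · rw [hb] at hdm
          unfold stepN
          rw [hb, if_neg (by omega), if_neg (by omega), if_pos (by omega)]
          have e : k * W + M + r.val - k * W - M = r.val := by omega
          rw [e]
          rcases hpass with h | h | h
          · rw [if_pos (by omega)] at ih
            rw [if_neg (by omega), ih, if_pos (by omega)]
          · rw [if_neg (by omega), if_neg (by omega), if_pos (by omega)] at ih
            rw [ih, if_pos hTl, if_neg (show ¬ t + 1 ≤ n * i + (i * W + q) by omega),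
              if_neg (show ¬ t + 1 ≤ n * i + (k * W + l) by omega),
              if_neg (show ¬ t + 1 ≤ n * i + (k * W + M + r) by omega)]
            simp only [hTr]
          · rw [if_neg (by omega), if_neg (by omega), if_neg (by omega)] at ih
            have h5 : ¬ st.val < W := by rw [ih]; split_ifs <;> omega
            rw [if_neg h5, if_neg (by omega), if_neg (by omega), if_neg (by omega)]
            exact ih
      rw [hval _ (by rw [hstep]; split_ifs <;> omega)]
      simp only [hb, decide_true, if_true]
      exact hstep
    · have hfalse : (bigδ T n t st (decide (t % n = i * W + q ∨ t % n = k * W + l ∨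
          t % n = k * W + M + r))).val = st.val := by
        simp [bigδ, hb]
      rw [hfalse, ih]
      push Not at hb
      obtain ⟨hb1, hb2, hb3⟩ := hb
      rcases hpass with h | h | h <;> split_ifs <;> omega

theorem big_final {k M W n : ℕ} (T : Fin k → Fin M → Fin W → Fin W)
    (hn : k * W + M + W ≤ n) (i : Fin k) (l : Fin M) (q r : Fin W) :
    detState (Equiv.refl (Fin n)) ⟨W + 1, by omega⟩ (bigδ T n)
      (extInput (probe (k * W + M + W) (i * W + q) (k * W + l) (k * W + M + r))) (k * n)
      ∈ ({⟨W, by omega⟩} : Finset (Fin (W + 2))) ↔ T i l q = r := by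
  rw [Finset.mem_singleton, Fin.ext_iff, big_run T hn i l q r]
  have hiW : i.val * W + q.val < k * W := by
    have h1 : (i.val + 1) * W ≤ k * W := Nat.mul_le_mul_right _ i.is_lt
    have := q.is_lt
    rw [Nat.add_mul] at h1
    omega
  have h1 : n * (i.val + 1) ≤ n * k := Nat.mul_le_mul_left _ i.is_lt
  rw [Nat.mul_add, Nat.mul_comm n k] at h1
  have hl := l.is_lt
  have hr := r.is_lt
  rw [if_neg (by omega), if_neg (by omega), if_neg (by omega)]
  split_ifs with h
  · simp [h]
  · simp [h]

/-! ## Counting -/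

theorem count_ineq (k W v M m : ℕ) (hk : 2 ≤ k) (hW : 62 ≤ W) (hv : 16 * v ≤ W)
    (hM : M = k * W) (hm : m = k * W + M + W) :
    m ^ m * (v * (((v ^ 2) ^ v) ^ (k * m) * 2 ^ v)) < ((W ^ W) ^ M) ^ k := by
  have hmM : m ≤ 3 * M := by nlinarith
  have hW1 : 1 ≤ W := by omega
  have hM1 : W ≤ M := by rw [hM]; nlinarith
  have h3k : 3 * k ≤ W ^ k := by
    have h0 : 3 * k ≤ 4 ^ k := by
      clear hm hM hk
      induction k with
      | zero => simp
      | succ k ih => 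
        rw [pow_succ]
        have : 1 ≤ 4 ^ k := Nat.one_le_pow _ _ (by norm_num)
        omega
    exact h0.trans (Nat.pow_le_pow_left (by omega) k)
  have hmW : m ≤ W ^ (k + 1) := by
    calc m ≤ 3 * M := hmM
      _ = 3 * k * W := by rw [hM]; ring
      _ ≤ W ^ k * W := Nat.mul_le_mul_right _ h3k
      _ = _ := by rw [pow_succ]
  have e1 : m ^ m ≤ W ^ ((k + 1) * m) := by
    rw [pow_mul]; exact Nat.pow_le_pow_left hmW m
  have e2 : v ≤ W ^ 1 := by rw [pow_one]; omega
  have e3 : ((v ^ 2) ^ v) ^ (k * m) ≤ W ^ (2 * v * (k * m)) := by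
    rw [← pow_mul, ← pow_mul, ← mul_assoc]; exact Nat.pow_le_pow_left (by omega) _
  have e4 : 2 ^ v ≤ W ^ v := Nat.pow_le_pow_left (by omega) v
  calc m ^ m * (v * (((v ^ 2) ^ v) ^ (k * m) * 2 ^ v))
      ≤ W ^ ((k + 1) * m) * (W ^ 1 * (W ^ (2 * v * (k * m)) * W ^ v)) := by gcongr
    _ = W ^ ((k + 1) * m + (1 + (2 * v * (k * m) + v))) := by
        simp only [pow_add]
    _ < W ^ (W * M * k) := by
        apply Nat.pow_lt_pow_right (by omega)
        have f1 : (k + 1) * m ≤ 2 * k * (3 * M) := Nat.mul_le_mul (by omega) hmM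
        have f2 : 2 * v * (k * m) ≤ 2 * v * (k * (3 * M)) := by gcongr
        have f3 : 16 * v * (k * M) ≤ W * (k * M) := Nat.mul_le_mul_right _ hv
        have f4 : 62 * (k * M) ≤ W * (k * M) := Nat.mul_le_mul_right _ hW
        have f5 : 2 * W ≤ k * M := Nat.mul_le_mul hk hM1
        have g1 : 2 * k * (3 * M) = 6 * (k * M) := by ring
        have g2 : 2 * v * (k * (3 * M)) = 6 * (v * (k * M)) := by ring
        have g3 : 16 * v * (k * M) = 16 * (v * (k * M)) := by ring
        have g4 : W * M * k = W * (k * M) := by ring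
        omega
    _ = ((W ^ W) ^ M) ^ k := by rw [← pow_mul, ← pow_mul, mul_assoc]

/-- Width hierarchy for deterministic `k`-OBDDs: for `k ≥ 2`, `w ≥ 64` and
`2kw(2w + ⌈log₂ k⌉ + ⌈log₂ 2w⌉) < n` there is a Boolean function computed by a
deterministic `k`-OBDD of width `w` but not by any of width `⌊w/16⌋ - 3`. -/
theorem det_kOBDD_width_hierarchy (k w n : ℕ) (hk : 2 ≤ k) (hw : 64 ≤ w)
    (hn : 2 * k * w * (2 * w + Nat.clog 2 k + Nat.clog 2 (2 * w)) < n) :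
    ∃ f : (Fin n → Bool) → Bool,
      detComputes k w n f ∧ ¬ detComputes k (w / 16 - 3) n f := by
  classical
  obtain ⟨W, rfl⟩ : ∃ W, w = W + 2 := ⟨w - 2, by omega⟩
  generalize hv : (W + 2) / 16 - 3 = v
  have hW : 62 ≤ W := by omega
  have hvW : 16 * v ≤ W := by omega
  obtain ⟨M, hM⟩ : ∃ M, M = k * W := ⟨_, rfl⟩
  have hmn : k * W + M + W ≤ n := by
    have h1 : 2 * k * (W + 2) * 2 ≤
        2 * k * (W + 2) * (2 * (W + 2) + Nat.clog 2 k + Nat.clog 2 (2 * (W + 2))) :=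
      Nat.mul_le_mul_left _ (by omega)
    have h2 : 2 * k * (W + 2) * 2 = 4 * (k * W) + 8 * k := by ring
    have h3 : 1 * W ≤ k * W := Nat.mul_le_mul_right _ (by omega)
    omega
  have hm : 0 < k * W + M + W := by omega
  by_contra hcon
  push Not at hcon
  have hdata : ∀ T : Fin k → Fin M → Fin W → Fin W,
      ∃ d : (Fin (k * W + M + W) → Fin (k * W + M + W)) × (Fin v) ×
        (Fin (k * (k * W + M + W)) → Fin v → Bool → Fin v) × Finset (Fin v),
        ∀ y, detState (Equiv.refl (Fin n)) ⟨W + 1, by omega⟩ (bigδ T n) (extInput y) (k * n)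
          ∈ ({⟨W, by omega⟩} : Finset (Fin (W + 2))) ↔
          redRun hm d.1 d.2.1 d.2.2.1 y (k * (k * W + M + W)) ∈ d.2.2.2 := by
    intro T
    obtain ⟨π, s, δ, A, hA⟩ := hcon (fun x => decide
      (detState (Equiv.refl (Fin n)) ⟨W + 1, by omega⟩ (bigδ T n) x (k * n)
          ∈ ({⟨W, by omega⟩} : Finset (Fin (W + 2)))))
      ⟨Equiv.refl _, ⟨W + 1, by omega⟩, bigδ T n, {⟨W, by omega⟩}, fun x => by simp⟩
    obtain ⟨τ, G, A', h⟩ := restrict_program (k := k) hm hmn π s δ A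
    refine ⟨⟨τ, s, G, A'⟩, fun y => ?_⟩
    rw [← h y, hA, decide_eq_true_iff]
  choose d hd using hdata
  have hinj : Function.Injective d := by
    intro T T' hTT
    funext i l q
    have h1 := big_final T hmn i l q (T' i l q)
    have h2 := big_final T' hmn i l q (T' i l q)
    rw [hd T, hTT, ← hd T'] at h1
    exact h1.1 (h2.2 rfl)
  have hcard := Fintype.card_le_of_injective d hinj
  have hlt := count_ineq k W v M _ hk hW hvW hM rfl
  simp only [Fintype.card_prod, Fintype.card_pi, Fintype.card_fin, Finset.prod_const,
    Finset.card_univ, Fintype.card_bool, Fintype.card_finset] at hcard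
  exact absurd hcard (not_le.2 hlt)
end

section
/- For all integers k ≥ 1, w ≥ 8 and n with 2·k·w·(2·w + ⌈log₂ k⌉ + ⌈log₂ (2·w)⌉) < n, there exists a Boolean function f : (Fin n → Bool) → Bool that is computed by some nondeterministic 2k-OBDD of width 3·w + 1 with some order π, but is not computed by any nondeterministic 2k-OBDD of width ⌊√w / 2⌋ with any order. -/
/-- `f` is computed by some nondeterministic `k`-OBDD of width `w` on `n` variables
(with some order `π`). -/
def nondetComputes (k w n : ℕ) (f : (Fin n → Bool) → Bool) : Prop :=
  ∃ (π : Equiv.Perm (Fin n)) (s : Fin w) (δ : ℕ → Fin w → Bool → Set (Fin w))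
    (A : Set (Fin w)),
    ∀ x : Fin n → Bool, nondetAccepts k π s δ A x ↔ f x = true

/-- Value of input at a natural number position. -/
def natBit {n : ℕ} (x : Fin n → Bool) (t : ℕ) : Bool :=
  if h : t < n then x ⟨t, h⟩ else false

/-- Set of reachable states after `j` steps. -/
def runSet {n w : ℕ} (π : Equiv.Perm (Fin n)) (s : Fin w)
    (δ : ℕ → Fin w → Bool → Set (Fin w)) (x : Fin n → Bool) : ℕ → Set (Fin w)
  | 0 => {s}
  | j + 1 => {q | ∃ p ∈ runSet π s δ x j, q ∈ δ j p (readBit π x j)}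

lemma mem_runSet {n w : ℕ} (π : Equiv.Perm (Fin n)) (s : Fin w)
    (δ : ℕ → Fin w → Bool → Set (Fin w)) (x : Fin n → Bool) (j : ℕ) (a : Fin w) :
    a ∈ runSet π s δ x j ↔ ∃ q : ℕ → Fin w, q 0 = s ∧
      (∀ i < j, q (i + 1) ∈ δ i (q i) (readBit π x i)) ∧ q j = a := by
  induction j generalizing a with
  | zero =>
    simp only [runSet, Set.mem_singleton_iff]
    constructor
    · intro h
      exact ⟨fun _ => s, rfl, by simp, h.symm⟩
    · rintro ⟨q, h0, -, h⟩
      rw [← h, h0]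
  | succ j ih =>
    simp only [runSet, Set.mem_ofPred_eq]
    constructor
    · rintro ⟨p, hp, hq⟩
      obtain ⟨q, h0, h1, h2⟩ := (ih p).1 hp
      refine ⟨Function.update q (j + 1) a, ?_, ?_, by simp⟩
      · rw [Function.update_of_ne (by omega), h0]
      · intro i hi
        rw [Function.update_of_ne (show i ≠ j + 1 by omega)]
        by_cases hij : i = j
        · subst hij
          rw [Function.update_self, h2]
          exact hq
        · rw [Function.update_of_ne (by omega)]
          exact h1 i (by omega)
    · rintro ⟨q, h0, h1, h2⟩
      refine ⟨q j, (ih _).2 ⟨q, h0, fun i hi => h1 i (by omega), rfl⟩, ?_⟩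
      rw [← h2]
      exact h1 j (by omega)

lemma accepts_iff_runSet {n w : ℕ} (k : ℕ) (π : Equiv.Perm (Fin n)) (s : Fin w)
    (δ : ℕ → Fin w → Bool → Set (Fin w)) (A : Set (Fin w)) (x : Fin n → Bool) :
    nondetAccepts k π s δ A x ↔ ∃ a ∈ A, a ∈ runSet π s δ x (k * n) := by
  simp only [mem_runSet, nondetAccepts]
  constructor
  · rintro ⟨q, h0, h1, h2⟩
    exact ⟨_, h2, q, h0, h1, rfl⟩
  · rintro ⟨a, ha, q, h0, h1, h2⟩
    exact ⟨q, h0, h1, h2 ▸ ha⟩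

/-! ### The function and the upper bound -/

/-- The hard function condition. -/
def hardProp {n : ℕ} (K W M : ℕ) (C : ℕ → ℕ → ℕ → Prop) (x : Fin n → Bool) : Prop :=
  ∃ i u j, i < K ∧ u < W ∧ j < M ∧ C i u j ∧ natBit x u = true ∧ natBit x (W + j) = true ∧
    natBit x (W + M + i) = true

/-- Transition relation of the program for the hard function, on natural-number states. -/
def hardStep (W M : ℕ) (C : ℕ → ℕ → ℕ → Prop) (i r p : ℕ) (b : Bool) (q : ℕ) : Prop :=
  (p = 0 ∧ q = 0) ∨ (p = 2 ∧ q = 2) ∨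
  (r < W ∧ p = 0 ∧ b = true ∧ q = 3 + r) ∨
  (r < W + M ∧ 3 ≤ p ∧ q = p) ∨
  (W ≤ r ∧ r < W + M ∧ 3 ≤ p ∧ b = true ∧ C i (p - 3) (r - W) ∧ q = 1) ∨
  (r < W + M + i ∧ p = 1 ∧ q = 1) ∨
  (r = W + M + i ∧ p = 1 ∧ b = true ∧ q = 2)

lemma readBit_refl {n : ℕ} (hn : 0 < n) (x : Fin n → Bool) (t : ℕ) :
    readBit (Equiv.refl (Fin n)) x t = natBit x (t % n) := by
  simp [readBit, natBit, hn, Nat.mod_lt]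

/-- Soundness invariant. -/
def hardInv {n : ℕ} (K W M : ℕ) (C : ℕ → ℕ → ℕ → Prop) (x : Fin n → Bool) (i r p : ℕ) : Prop :=
  (3 ≤ p → p - 3 < W ∧ natBit x (p - 3) = true ∧ r ≤ W + M) ∧
  (p = 1 → r ≤ W + M + i ∧
    ∃ u j, u < W ∧ j < M ∧ C i u j ∧ natBit x u = true ∧ natBit x (W + j) = true) ∧
  (p = 2 → hardProp K W M C x)

lemma hardInv_step {n : ℕ} (K W M : ℕ) (C : ℕ → ℕ → ℕ → Prop) (x : Fin n → Bool) (i r p q : ℕ)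
    (hi : i < K) (h : hardInv K W M C x i r p) (hs : hardStep W M C i r p (natBit x r) q) :
    hardInv K W M C x i (r + 1) q := by
  obtain ⟨h3, h1, h2⟩ := h
  rcases hs with ⟨a, b⟩ | ⟨a, b⟩ | ⟨a, b, c, d⟩ | ⟨a, b, c⟩ | ⟨a, b, c, d, e, g⟩ | ⟨a, b, c⟩ |
    ⟨a, b, c, d⟩
  · subst b; refine ⟨by omega, by omega, by omega⟩
  · subst b; exact ⟨by omega, by omega, fun _ => h2 a⟩
  · subst d
    refine ⟨fun _ => ⟨by omega, ?_, by omega⟩, by omega, by omega⟩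
    rwa [Nat.add_sub_cancel_left]
  · subst c
    exact ⟨fun _ => ⟨(h3 b).1, (h3 b).2.1, by omega⟩, by omega, by omega⟩
  · subst g
    refine ⟨by omega, fun _ => ⟨by omega, p - 3, r - W, (h3 c).1, by omega, e, (h3 c).2.1, ?_⟩,
      by omega⟩
    rwa [Nat.add_sub_cancel' a]
  · subst c
    exact ⟨by omega, fun _ => ⟨by omega, (h1 b).2⟩, by omega⟩
  · subst d
    refine ⟨by omega, by omega, fun _ => ?_⟩
    obtain ⟨-, u, j, hu, hj, hC, hxu, hxj⟩ := h1 b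
    exact ⟨i, u, j, hi, hu, hj, hC, hxu, hxj, a ▸ c⟩

lemma upper_bound (K W M n V : ℕ) (C : ℕ → ℕ → ℕ → Prop) (hn : W + M + K < n) (hV : W + 3 ≤ V)
    (f : (Fin n → Bool) → Bool) (hf : ∀ x, f x = true ↔ hardProp K W M C x) :
    nondetComputes K V n f := by
  have hn0 : 0 < n := by omega
  refine ⟨Equiv.refl _, ⟨0, by omega⟩,
    fun j p b => {q | hardStep W M C (j / n) (j % n) p.1 b q.1}, {q | q.1 = 2}, fun x => ?_⟩
  rw [hf]
  constructor
  · rintro ⟨q, h0, h1, h2⟩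
    have key : ∀ j, j ≤ K * n → hardInv K W M C x (j / n) (j % n) (q j).1 := by
      intro j
      induction j with
      | zero =>
        intro _
        rw [h0]
        exact ⟨by simp, by simp, by simp⟩
      | succ j ih =>
        intro hj
        have hs := h1 j (by omega)
        rw [readBit_refl hn0] at hs
        have hs' : hardStep W M C (j / n) (j % n) (q j).1 (natBit x (j % n)) (q (j + 1)).1 := hs
        have hi : j / n < K := by
          rw [Nat.div_lt_iff_lt_mul hn0]; omega
        have hstep := hardInv_step K W M C x _ _ _ _ hi (ih (by omega)) hs'
        have hr : j % n < n := Nat.mod_lt _ hn0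
        by_cases hlt : j % n + 1 < n
        · have e1 : (j + 1) / n = j / n := by
            conv_lhs => rw [← Nat.div_add_mod j n]
            rw [add_assoc, Nat.mul_add_div hn0, Nat.div_eq_of_lt hlt, add_zero]
          have e2 : (j + 1) % n = j % n + 1 := by
            conv_lhs => rw [← Nat.div_add_mod j n]
            rw [add_assoc, Nat.mul_add_mod, Nat.mod_eq_of_lt hlt]
          rw [e1, e2]
          exact hstep
        · obtain ⟨h3, h1', h2'⟩ := hstep
          refine ⟨fun h => ?_, fun h => ?_, h2'⟩
          · have := (h3 h).2.2
            omega
          · have := (h1' h).1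
            omega
    exact (key _ le_rfl).2.2 h2
  · rintro ⟨i, u, j, hi, hu, hj, hC, hxu, hxj, hxi⟩
    have hin : i * n + n ≤ K * n := by
      calc i * n + n = (i + 1) * n := by ring
        _ ≤ K * n := Nat.mul_le_mul_right _ hi
    obtain ⟨q, q0, qu, q1, q2⟩ : ∃ q : ℕ → Fin V, (∀ t, t ≤ i * n + u → (q t).1 = 0) ∧
        (∀ t, i * n + u < t → t ≤ i * n + (W + j) → (q t).1 = 3 + u) ∧
        (∀ t, i * n + (W + j) < t → t ≤ i * n + (W + M + i) → (q t).1 = 1) ∧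
        (∀ t, i * n + (W + M + i) < t → (q t).1 = 2) := by
      refine ⟨fun t => if t ≤ i * n + u then ⟨0, by omega⟩ else
        if t ≤ i * n + (W + j) then ⟨3 + u, by omega⟩ else
        if t ≤ i * n + (W + M + i) then ⟨1, by omega⟩ else ⟨2, by omega⟩, ?_, ?_, ?_, ?_⟩
      · intro t h
        simp [h]
      · intro t h h'
        simp [h', show ¬ t ≤ i * n + u by omega]
      · intro t h h'
        simp [h', show ¬ t ≤ i * n + u by omega, show ¬ t ≤ i * n + (W + j) by omega]
      · intro t h
        simp [show ¬ t ≤ i * n + u by omega, show ¬ t ≤ i * n + (W + j) by omega,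
          show ¬ t ≤ i * n + (W + M + i) by omega]
    refine ⟨q, Fin.ext (q0 0 (Nat.zero_le _)), ?_, q2 _ (by omega)⟩
    intro t ht
    rw [readBit_refl hn0]
    change hardStep W M C (t / n) (t % n) (q t).1 _ (q (t + 1)).1
    have hmid : ∀ r, r < n → t = i * n + r → t / n = i ∧ t % n = r := by
      intro r hr h
      subst h
      rw [mul_comm i n, Nat.mul_add_div hn0, Nat.div_eq_of_lt hr, Nat.mul_add_mod,
        Nat.mod_eq_of_lt hr]
      simp
    rcases lt_or_ge t (i * n + u) with h | h
    · left
      exact ⟨q0 _ (by omega), q0 _ (by omega)⟩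
    rcases lt_or_ge t (i * n + (W + M + i) + 1) with h' | h'
    · obtain ⟨r, rfl⟩ : ∃ r, t = i * n + r := ⟨t - i * n, by omega⟩
      obtain ⟨e1, e2⟩ := hmid r (by omega) rfl
      rw [e1, e2]
      clear e1 e2 hmid
      rcases lt_trichotomy r u with h1 | h1 | h1
      · omega
      · subst h1
        right; right; left
        exact ⟨hu, q0 _ le_rfl, hxu, qu _ (by omega) (by omega)⟩
      rcases lt_trichotomy r (W + j) with h2 | h2 | h2
      · right; right; right; left
        rw [qu (i * n + r) (by omega) (by omega), qu (i * n + r + 1) (by omega) (by omega)]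
        exact ⟨by omega, by omega, rfl⟩
      · subst h2
        right; right; right; right; left
        rw [qu (i * n + (W + j)) (by omega) (by omega)]
        refine ⟨by omega, by omega, by omega, hxj, ?_, q1 _ (by omega) (by omega)⟩
        simpa using hC
      rcases lt_trichotomy r (W + M + i) with h3 | h3 | h3
      · right; right; right; right; right; left
        exact ⟨h3, q1 _ (by omega) (by omega), q1 _ (by omega) (by omega)⟩
      · subst h3
        right; right; right; right; right; right
        exact ⟨rfl, q1 _ (by omega) (by omega), hxi, q2 _ (by omega)⟩
      · omega
    · right; left
      exact ⟨q2 _ (by omega), q2 _ (by omega)⟩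

/-! ### The lower bound: counting restricted programs -/

/-- Extension of a short input by zeros. -/
def extBits {N : ℕ} (n : ℕ) (y : Fin N → Bool) : Fin n → Bool := fun i => natBit y i.1

/-- State sets of a restricted program. -/
def evSet {N d : ℕ} (v : ℕ → Fin N) (S : Set (Fin d)) (R : ℕ → Bool → Fin d → Set (Fin d))
    (y : Fin N → Bool) : ℕ → Set (Fin d)
  | 0 => S
  | t + 1 => {q | ∃ p ∈ evSet v S R y t, q ∈ R t (y (v t)) p}

lemma evSet_congr {N d : ℕ} (v v' : ℕ → Fin N) (S : Set (Fin d))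
    (R R' : ℕ → Bool → Fin d → Set (Fin d)) (y : Fin N → Bool) (t : ℕ)
    (hv : ∀ i < t, v i = v' i) (h : ∀ i < t, R i = R' i) :
    evSet v S R y t = evSet v' S R' y t := by
  induction t with
  | zero => rfl
  | succ t ih =>
    simp only [evSet]
    rw [ih (fun i hi => hv i (by omega)) (fun i hi => h i (by omega)), h t (by omega),
      hv t (by omega)]

lemma restrict_run {n N d : ℕ} (π : Equiv.Perm (Fin n)) (s : Fin d)
    (δ : ℕ → Fin d → Bool → Set (Fin d)) (P : ℕ → Prop) [DecidablePred P] (v : ℕ → Fin N)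
    (hP : ∀ j, P j → ∀ y : Fin N → Bool, readBit π (extBits n y) j = y (v (Nat.count P j)))
    (hnP : ∀ j, ¬ P j → ∀ y : Fin N → Bool, readBit π (extBits n y) j = false) (j : ℕ) :
    ∃ S R, ∀ y : Fin N → Bool, runSet π s δ (extBits n y) j = evSet v S R y (Nat.count P j) := by
  induction j with
  | zero => exact ⟨{s}, fun _ _ _ => ∅, fun y => by simp [runSet, evSet]⟩
  | succ j ih =>
    obtain ⟨S, R, h⟩ := ih
    by_cases hj : P j
    · rw [Nat.count_succ, if_pos hj]
      refine ⟨S, Function.update R (Nat.count P j) (fun b p => δ j p b), fun y => ?_⟩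
      have hc : evSet v S (Function.update R (Nat.count P j) (fun b p => δ j p b)) y
          (Nat.count P j) = evSet v S R y (Nat.count P j) := by
        apply evSet_congr _ _ _ _ _ _ _ (fun _ _ => rfl)
        intro i hi
        rw [Function.update_of_ne (by omega)]
      simp only [runSet, evSet, Function.update_self]
      rw [h y, hP j hj y, hc]
    · rw [Nat.count_succ, if_neg hj, add_zero]
      rcases Nat.eq_zero_or_eq_succ_pred (Nat.count P j) with h0 | h0
      · rw [h0] at h ⊢
        refine ⟨{q | ∃ p ∈ S, q ∈ δ j p false}, R, fun y => ?_⟩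
        simp only [runSet, evSet] at h ⊢
        rw [h y, hnP j hj y]
      · generalize (Nat.count P j).pred = t at h0
        rw [h0] at h ⊢
        refine ⟨S, Function.update R t (fun b p => {q | ∃ p' ∈ R t b p, q ∈ δ j p' false}),
          fun y => ?_⟩
        have hc : evSet v S (Function.update R t
            (fun b p => {q | ∃ p' ∈ R t b p, q ∈ δ j p' false})) y t = evSet v S R y t := by
          apply evSet_congr _ _ _ _ _ _ _ (fun _ _ => rfl)
          intro i hi
          rw [Function.update_of_ne (by omega)]
        simp only [runSet, evSet, Function.update_self] at h ⊢
        rw [h y, hnP j hj y, hc]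
        ext q
        simp only [Set.mem_ofPred_eq]
        constructor
        · rintro ⟨p, ⟨p', h1, h2⟩, h3⟩
          exact ⟨p', h1, p, h2, h3⟩
        · rintro ⟨p', h1, p, h2, h3⟩
          exact ⟨p, ⟨p', h1, h2⟩, h3⟩

/-- Encodings of restricted programs. -/
abbrev Enc (K N d : ℕ) : Type :=
  (Fin N → Fin N) × Set (Fin d) × (Fin (K * N) → Bool → Fin d → Set (Fin d)) × Set (Fin d)

/-- Function computed by an encoding. -/
def decEnc {K N d : ℕ} (hN : 0 < N) (e : Enc K N d) (y : Fin N → Bool) : Prop :=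
  ∃ a ∈ e.2.2.2, a ∈ evSet (fun t => e.1 ⟨t % N, Nat.mod_lt t hN⟩) e.2.1
    (fun t => if h : t < K * N then e.2.2.1 ⟨t, h⟩ else fun _ _ => ∅) y (K * N)

lemma count_periodic (n N : ℕ) (P : ℕ → Prop) [DecidablePred P]
    (hper : ∀ j, P (n + j) ↔ P j) (hc : Nat.count P n = N) (a r : ℕ) :
    Nat.count P (a * n + r) = a * N + Nat.count P r := by
  induction a with
  | zero => simp
  | succ a ih =>
    have : (a + 1) * n + r = n + (a * n + r) := by ring
    rw [this, Nat.count_add, hc]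
    have h2 : Nat.count (fun k => P (n + k)) (a * n + r) = Nat.count P (a * n + r) := by
      simp only [hper]
    rw [h2, ih]; ring

lemma exists_enc {n N d K : ℕ} (hN : 0 < N) (hNn : N ≤ n) (f : (Fin n → Bool) → Bool)
    (hf : nondetComputes K d n f) :
    ∃ e : Enc K N d, ∀ y, decEnc hN e y ↔ f (extBits n y) = true := by
  classical
  obtain ⟨π, s, δ, A, hcomp⟩ := hf
  have hn : 0 < n := by omega
  let rd : ℕ → ℕ := fun j => (π ⟨j % n, Nat.mod_lt j hn⟩).1
  let P : ℕ → Prop := fun j => rd j < N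
  have hrdper : ∀ j, rd (j % n) = rd j := by
    intro j; simp only [rd, Nat.mod_mod]
  have hper : ∀ j, P (n + j) ↔ P j := by
    intro j
    simp only [P]
    rw [← hrdper (n + j), Nat.add_mod_left, hrdper]
  have hc : Nat.count P n = N := by
    rw [Nat.count_eq_card_filter_range]
    refine Eq.trans (Finset.card_bij (t := Finset.range N) (fun a _ => rd a) ?_ ?_ ?_)
      (Finset.card_range N)
    · intro a ha
      simp only [Finset.mem_filter, P] at ha
      simpa using ha.2
    · intro a ha b hb hab
      simp only [Finset.mem_filter, Finset.mem_range] at ha hb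
      have := π.injective (Fin.ext hab)
      simpa [Nat.mod_eq_of_lt ha.1, Nat.mod_eq_of_lt hb.1] using this
    · intro b hb
      have hb' : b < N := by simpa using hb
      have hr : rd (π.symm ⟨b, by omega⟩).1 = b := by
        simp [rd, Nat.mod_eq_of_lt]
      refine ⟨(π.symm ⟨b, by omega⟩).1, ?_, hr⟩
      simp only [Finset.mem_filter, Finset.mem_range, P]
      exact ⟨Fin.is_lt _, by rw [hr]; exact hb'⟩
  let σ : Fin N → Fin N := fun m =>
    if h : rd (Nat.nth P m.1) < N then ⟨rd (Nat.nth P m.1), h⟩ else ⟨0, hN⟩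
  let v : ℕ → Fin N := fun t => σ ⟨t % N, Nat.mod_lt t hN⟩
  have hv : ∀ j, P j → (v (Nat.count P j)).1 = rd j := by
    intro j hj
    have hj' : P (j % n) := by simp only [P]; rw [hrdper]; exact hj
    have h1 : Nat.count P j % N = Nat.count P (j % n) := by
      have h2 : Nat.count P j = (j / n) * N + Nat.count P (j % n) := by
        rw [← count_periodic n N P hper hc]
        congr 1
        rw [mul_comm]; exact (Nat.div_add_mod j n).symm
      have h3 : Nat.count P (j % n) < N := by
        exact lt_of_lt_of_eq (Nat.count_strict_mono hj' (Nat.mod_lt _ hn)) hc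
      rw [h2, mul_comm, Nat.mul_add_mod, Nat.mod_eq_of_lt h3]
    have h4 : rd (Nat.nth P (Nat.count P j % N)) = rd j := by
      rw [h1, Nat.nth_count hj', hrdper]
    simp only [v, σ]
    rw [dif_pos (by rw [h4]; exact hj)]
    exact h4
  have hread : ∀ j (y : Fin N → Bool), readBit π (extBits n y) j = natBit y (rd j) := by
    intro j y
    simp [readBit, hn, extBits, rd]
  obtain ⟨S, R, h⟩ := restrict_run (N := N) π s δ P v
    (by
      intro j hj y
      rw [hread, ← hv j hj]
      simp [natBit])
    (by
      intro j hj y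
      rw [hread, natBit, dif_neg hj]) (K * n)
  have hcK : Nat.count P (K * n) = K * N := by
    have := count_periodic n N P hper hc K 0
    simpa using this
  refine ⟨(σ, S, fun t => R t.1, A), fun y => ?_⟩
  rw [← hcomp, accepts_iff_runSet, h y, hcK]
  simp only [decEnc]
  rw [evSet_congr _ v S _ R y (K * N) (fun _ _ => rfl)]
  intro i hi
  rw [dif_pos hi]

lemma card_enc (K N d : ℕ) :
    Nat.card (Enc K N d) = N ^ N * (2 ^ d * (2 ^ (d * d * 2 * (K * N)) * 2 ^ d)) := by
  classical
  simp [Enc, Nat.card_eq_fintype_card, pow_mul]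

/-- Natural-number version of a coefficient table. -/
def natC {K W M : ℕ} (C : Fin K → Fin W → Fin M → Bool) (i u j : ℕ) : Prop :=
  ∃ (hi : i < K) (hu : u < W) (hj : j < M), C ⟨i, hi⟩ ⟨u, hu⟩ ⟨j, hj⟩ = true

lemma natBit_extBits {N n : ℕ} (hNn : N ≤ n) (y : Fin N → Bool) (t : ℕ) :
    natBit (extBits n y) t = natBit y t := by
  by_cases h : t < n
  · simp [natBit, extBits, h]
  · simp [natBit, h, show ¬ t < N by omega]

lemma hardProp_onehot {K W M n : ℕ} (hNn : W + M + K ≤ n) (C : Fin K → Fin W → Fin M → Bool)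
    (i : Fin K) (u : Fin W) (j : Fin M) :
    hardProp K W M (natC C) (extBits n (fun t : Fin (W + M + K) =>
      decide (t.1 = u.1 ∨ t.1 = W + j.1 ∨ t.1 = W + M + i.1))) ↔ C i u j = true := by
  have hi := i.2
  have hu := u.2
  have hj := j.2
  simp only [hardProp, natBit_extBits hNn]
  constructor
  · rintro ⟨i', u', j', hi', hu', hj', ⟨_, _, _, hC⟩, h1, h2, h3⟩
    simp only [natBit, show u' < W + M + K by omega, show W + j' < W + M + K by omega,
      show W + M + i' < W + M + K by omega, dif_pos, decide_eq_true_eq] at h1 h2 h3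
    obtain rfl : u' = u.1 := by omega
    obtain rfl : j' = j.1 := by omega
    obtain rfl : i' = i.1 := by omega
    exact hC
  · intro h
    refine ⟨i, u, j, hi, hu, hj, ⟨hi, hu, hj, h⟩, ?_, ?_, ?_⟩
    · simp [natBit, show u.1 < W + M + K by omega]
    · simp [natBit, show W + j.1 < W + M + K by omega]
    · simp [natBit]

lemma exists_hard {K W M n d : ℕ} (hpos : 0 < W + M + K) (hNn : W + M + K ≤ n)
    (hcard : Nat.card (Enc K (W + M + K) d) < 2 ^ (K * (W * M))) :
    ∃ (C : Fin K → Fin W → Fin M → Bool), ∀ f : (Fin n → Bool) → Bool,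
      (∀ x, f x = true ↔ hardProp K W M (natC C) x) → ¬ nondetComputes K d n f := by
  classical
  by_contra! hcon
  choose f hf hcomp using hcon
  choose e he using fun C => exists_enc hpos hNn (f C) (hcomp C)
  have hinj : Function.Injective e := by
    intro C C' h
    funext i u j
    rw [Bool.eq_iff_iff, ← hardProp_onehot hNn C, ← hardProp_onehot hNn C', ← hf C, ← hf C',
      ← he C, ← he C', h]
  have hle := Nat.card_le_card_of_injective e hinj
  have h2 : Nat.card (Fin K → Fin W → Fin M → Bool) = 2 ^ (K * (W * M)) := by
    simp only [Nat.card_eq_fintype_card, Fintype.card_fun, Fintype.card_bool, Fintype.card_fin]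
    rw [← pow_mul, ← pow_mul]
    congr 1; ring
  omega

lemma pow_bound (m : ℕ) (hm : 8 ≤ m) : 4 * (m + 1) ≤ 2 ^ (m - 1) := by
  induction m, hm using Nat.le_induction with
  | base => norm_num
  | succ m hm ih =>
    obtain ⟨t, rfl⟩ : ∃ t, m = t + 1 := ⟨m - 1, by omega⟩
    simp only [Nat.add_sub_cancel] at ih ⊢
    rw [pow_succ]; omega

lemma card_bound (k w d : ℕ) (hk : 1 ≤ k) (hw : 8 ≤ w) (hd : 4 * (d * d) ≤ w) :
    Nat.card (Enc (2 * k) (2 * w + 2 * (k + w) + 2 * k) d) <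
      2 ^ (2 * k * (2 * w * (2 * (k + w)))) := by
  rw [card_enc]
  have hN : 2 * w + 2 * (k + w) + 2 * k = 4 * (k + w) := by ring
  rw [hN]
  set N := 4 * (k + w) with hNdef
  have hkw : 8 ≤ k * w := by nlinarith
  have hsum : k + w ≤ k * w + 1 := by
    obtain ⟨a, rfl⟩ : ∃ a, k = a + 1 := ⟨k - 1, by omega⟩
    obtain ⟨b, rfl⟩ : ∃ b, w = b + 1 := ⟨w - 1, by omega⟩
    nlinarith [Nat.zero_le (a * b)]
  have h1 : N ≤ 2 ^ (k * w - 1) := le_trans (by omega) (pow_bound _ hkw)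
  have h2 : N ^ N ≤ 2 ^ ((k * w - 1) * N) := by
    exact (Nat.pow_le_pow_left h1 N).trans_eq (pow_mul _ _ _).symm
  have hdw : d ≤ w := by nlinarith [Nat.zero_le (d * d), Nat.le_mul_self d]
  calc N ^ N * (2 ^ d * (2 ^ (d * d * 2 * (2 * k * N)) * 2 ^ d))
      ≤ 2 ^ ((k * w - 1) * N) * (2 ^ d * (2 ^ (d * d * 2 * (2 * k * N)) * 2 ^ d)) :=
        Nat.mul_le_mul_right _ h2
    _ = 2 ^ ((k * w - 1) * N + (d + (d * d * 2 * (2 * k * N) + d))) := by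
        simp only [pow_add]
    _ < _ := by
        apply Nat.pow_lt_pow_right (by norm_num)
        obtain ⟨m, hm⟩ : ∃ m, k * w = m + 1 := ⟨k * w - 1, by omega⟩
        have e1 : 2 * k * (2 * w * (2 * (k + w))) = 2 * (k * w) * N := by rw [hNdef]; ring
        have e2 : d * d * 2 * (2 * k * N) ≤ k * w * N := by
          calc d * d * 2 * (2 * k * N) = 4 * (d * d) * (k * N) := by ring
            _ ≤ w * (k * N) := Nat.mul_le_mul_right _ hd
            _ = k * w * N := by ring
        have e3 : 2 * (k * w) * N = k * w * N + (m * N + N) := by rw [hm]; ring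
        rw [e1, e3, hm, Nat.add_sub_cancel, ← hm]
        omega

/-- Width hierarchy for nondeterministic `2k`-OBDDs: for `k ≥ 1`, `w ≥ 8` and
`2kw(2w + ⌈log₂ k⌉ + ⌈log₂ 2w⌉) < n` there is a Boolean function computed by a
nondeterministic `2k`-OBDD of width `3w + 1` but not by any of width `⌊√w / 2⌋`. -/
theorem nondet_kOBDD_width_hierarchy (k w n : ℕ) (hk : 1 ≤ k) (hw : 8 ≤ w)
    (hn : 2 * k * w * (2 * w + Nat.clog 2 k + Nat.clog 2 (2 * w)) < n) :
    ∃ f : (Fin n → Bool) → Bool,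
      nondetComputes (2 * k) (3 * w + 1) n f ∧
      ¬ nondetComputes (2 * k) ⌊Real.sqrt w / 2⌋₊ n f := by
  classical
  have hd : 4 * (⌊Real.sqrt w / 2⌋₊ * ⌊Real.sqrt w / 2⌋₊) ≤ w := by
    have h1 : (⌊Real.sqrt w / 2⌋₊ : ℝ) ≤ Real.sqrt w / 2 := Nat.floor_le (by positivity)
    have h2 : Real.sqrt w * Real.sqrt w = w := Real.mul_self_sqrt (by positivity)
    have h0 : (0 : ℝ) ≤ (⌊Real.sqrt w / 2⌋₊ : ℝ) := by positivity
    have h3 : (4 * ((⌊Real.sqrt w / 2⌋₊ : ℝ) * ⌊Real.sqrt w / 2⌋₊)) ≤ w := by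
      nlinarith
    exact_mod_cast h3
  have hlt : 2 * w + 2 * (k + w) + 2 * k < n := by
    have h1 : 2 * k * w * 16 ≤
        2 * k * w * (2 * w + Nat.clog 2 k + Nat.clog 2 (2 * w)) :=
      Nat.mul_le_mul_left _ (by omega)
    nlinarith [Nat.mul_le_mul hk hw, Nat.mul_le_mul_left k hw, Nat.mul_le_mul_right w hk]
  obtain ⟨C, hC⟩ := exists_hard (n := n) (by omega) hlt.le (card_bound k w _ hk hw hd)
  have hf : ∀ x : Fin n → Bool,
      (decide (hardProp (2 * k) (2 * w) (2 * (k + w)) (natC C) x)) = true ↔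
        hardProp (2 * k) (2 * w) (2 * (k + w)) (natC C) x := fun x => by simp
  exact ⟨_, upper_bound (2 * k) (2 * w) (2 * (k + w)) n (3 * w + 1) (natC C) hlt (by omega) _ hf,
    hC _ hf⟩
end

section
/- For all real constants C₁ > 0 and C₂ > 0 there exists W₀ such that for every integer k ≥ 2 and every real w ≥ W₀, w^(k·w/6) > (C₁·k·(C₂ + log₂ w + log₂ k))^((2k+1)·w/(log₂ k · log₂ w)²). -/
theorem logb_two_le_aux (x : ℝ) (hx : 0 < x) : Real.logb 2 x ≤ 2 * x := by
  have h1 := Real.log_le_sub_one_of_pos hx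
  have h2 := Real.log_two_gt_d9
  rw [Real.logb, div_le_iff₀ (by linarith)]
  nlinarith

/-- For all real constants `C₁, C₂ > 0` there exists `W₀` such that for every integer
`k ≥ 2` and every real `w ≥ W₀`,
`w^(k·w/6) > (C₁·k·(C₂ + log₂ w + log₂ k))^((2k+1)·w/(log₂ k · log₂ w)²)`. -/
theorem prob_hierarchy_arith (C₁ C₂ : ℝ) (hC₁ : 0 < C₁) (hC₂ : 0 < C₂) :
    ∃ W₀ : ℝ, ∀ k : ℕ, 2 ≤ k → ∀ w : ℝ, W₀ ≤ w →
      w ^ ((k : ℝ) * w / 6) >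
        (C₁ * k * (C₂ + Real.logb 2 w + Real.logb 2 k)) ^
          ((2 * (k : ℝ) + 1) * w / (Real.logb 2 k * Real.logb 2 w) ^ 2) := by
  obtain ⟨D, hD⟩ : ∃ D : ℝ, D = 2 * C₁ + 2 * C₂ + 5 := ⟨_, rfl⟩
  refine ⟨(2 : ℝ) ^ (18 * D + 1), fun k hk w hw => ?_⟩
  have hk2 : (2 : ℝ) ≤ k := by exact_mod_cast hk
  have hk0 : (0 : ℝ) < k := by linarith
  have hw0 : 0 < w := lt_of_lt_of_le (by positivity) hw
  have hL : 18 * D + 1 ≤ Real.logb 2 w := (Real.le_logb_iff_rpow_le one_lt_two hw0).2 hw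
  have hK : 1 ≤ Real.logb 2 k :=
    (Real.le_logb_iff_rpow_le one_lt_two hk0).2 (by simpa using hk2)
  have hD0 : 5 < D := by linarith
  have hKe : Real.logb 2 (k : ℝ) = Real.logb 2 k := rfl
  generalize hLL : Real.logb 2 w = L at *
  generalize hKK : Real.logb 2 (k : ℝ) = K at *
  have hS : 0 < C₂ + L + K := by linarith
  have hL1 : 1 ≤ L := by linarith
  have hB : Real.logb 2 (C₁ * k * (C₂ + L + K)) ≤ D * (K * L) := by
    rw [Real.logb_mul (by positivity) hS.ne', Real.logb_mul hC₁.ne' hk0.ne', hKK]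
    have h1 := logb_two_le_aux C₁ hC₁
    have h2 := logb_two_le_aux _ hS
    have h3 : K ≤ K * L := by nlinarith
    have h4 : L ≤ K * L := by nlinarith
    have h5 : 1 ≤ K * L := by linarith
    have h6 : 0 ≤ (2 * C₁ + 2 * C₂) * (K * L - 1) :=
      mul_nonneg (by linarith) (by linarith)
    rw [hD]
    nlinarith
  have hP : 0 < C₁ * k * (C₂ + L + K) := by positivity
  have hKL : 0 < K * L := by positivity
  rw [gt_iff_lt, ← Real.logb_lt_logb_iff one_lt_two (by positivity) (by positivity),
    Real.logb_rpow_eq_mul_logb_of_pos hP, Real.logb_rpow_eq_mul_logb_of_pos hw0, hLL]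
  calc (2 * (k : ℝ) + 1) * w / (K * L) ^ 2 * Real.logb 2 (C₁ * k * (C₂ + L + K))
      ≤ (2 * (k : ℝ) + 1) * w / (K * L) ^ 2 * (D * (K * L)) := by gcongr
    _ = (2 * (k : ℝ) + 1) * w * D / (K * L) := by field_simp
    _ ≤ (3 * k) * w * D / (K * L) := by gcongr; linarith
    _ < k * w / 6 * L := by
      rw [div_lt_iff₀ hKL]
      have h1 : 18 * D < L * (K * L) := by
        have : L ≤ K * L := by nlinarith
        nlinarith
      have h2 : 0 < (k : ℝ) * w := by positivity
      nlinarith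
end

section
/- For every integer k ≥ 2 and every real w ≥ 64, w^(k·w/6) > (⌊w/16⌋ − 3)^((2k−1)·(⌊w/16⌋ − 3) + 1). -/
/-- For every integer `k ≥ 2` and every real `w ≥ 64`,
`w^(k·w/6) > (⌊w/16⌋ - 3)^((2k-1)·(⌊w/16⌋ - 3) + 1)` (real powers). -/
theorem det_hierarchy_arith (k : ℕ) (hk : 2 ≤ k) (w : ℝ) (hw : 64 ≤ w) :
    w ^ ((k : ℝ) * w / 6) >
      ((⌊w / 16⌋₊ : ℝ) - 3) ^
        ((2 * (k : ℝ) - 1) * ((⌊w / 16⌋₊ : ℝ) - 3) + 1) := by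
  have hf : (⌊w / 16⌋₊ : ℝ) ≤ w / 16 := Nat.floor_le (by linarith)
  have hf4 : (4 : ℕ) ≤ ⌊w / 16⌋₊ := Nat.le_floor (by push_cast; linarith)
  have hf4' : (4 : ℝ) ≤ (⌊w / 16⌋₊ : ℝ) := by exact_mod_cast hf4
  have hk' : (2 : ℝ) ≤ k := by exact_mod_cast hk
  generalize (⌊w / 16⌋₊ : ℝ) = f at *
  have h1 : 0 ≤ (2 * (k : ℝ) - 1) * (f - 3) + 1 := by nlinarith
  have h2 : (2 * (k : ℝ) - 1) * (f - 3) + 1 < (k : ℝ) * w / 6 := by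
    have h3 : (k : ℝ) * (f - 3) ≤ k * (w / 16 - 3) :=
      mul_le_mul_of_nonneg_left (by linarith) (by linarith)
    have h4 : 0 < (k : ℝ) * w := by apply mul_pos <;> linarith
    nlinarith
  calc (f - 3) ^ ((2 * (k : ℝ) - 1) * (f - 3) + 1)
      ≤ w ^ ((2 * (k : ℝ) - 1) * (f - 3) + 1) :=
        Real.rpow_le_rpow (by linarith) (by linarith) h1
    _ < w ^ ((k : ℝ) * w / 6) := Real.rpow_lt_rpow_of_exponent_lt (by linarith) h2
end
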